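/- Let A ⊂ ℝ be a finite set with E⁺(A) ≤ |A|^{3−c} and Ē^×(A) ≤ |A|^{3−c} for some constant c > 0. Then C₄(A) − 2|A|⁵ ≪ |A|^{5−c/5} log^{4/5}|A|, where the implied constant may depend on c. -/

import Mathlib

open scoped Classical Pointwise

noncomputable section

/-- Number of collinear `k`-tuples of points of `A × B`. -/
def Ctuples (F : Type*) [Field F] (k : ℕ) (A B : Finset F) : ℕ :=
  ((Fintype.piFinset fun _ : Fin k => A ×ˢ B).filter fun f => Collinear F (Set.range f)).card

/-- Additive energy of two finite sets. -/
def addE (F : Type*) [Field F] (A B : Finset F) : ℕ :=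
  (((A ×ˢ A) ×ˢ B ×ˢ B).filter fun q => q.1.1 - q.2.1 = q.1.2 - q.2.2).card

/-- Multiplicative energy of two finite sets. -/
def mulE (F : Type*) [Field F] (A B : Finset F) : ℕ :=
  (((A ×ˢ A) ×ˢ B ×ˢ B).filter fun q => q.1.1 * q.2.2 = q.1.2 * q.2.1).card

/-- `max_s E^×(A - s)`. -/
def mulEbar (F : Type*) [Field F] (A : Finset F) : ℕ :=
  ⨆ s : F, mulE F (A.image fun a => a - s) (A.image fun a => a - s)

def repSub (F : Type*) [Field F] (A B : Finset F) (x : F) : ℕ :=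
  ((A ×ˢ B).filter fun q => q.1 - q.2 = x).card

def addEk (F : Type*) [Field F] (k : ℕ) (A : Finset F) : ℕ :=
  ∑ x ∈ A - A, repSub F A A x ^ k

def repDiv (F : Type*) [Field F] (A B : Finset F) (x : F) : ℕ :=
  ((A ×ˢ B).filter fun q => q.2 ≠ 0 ∧ q.1 / q.2 = x).card

def mulEk (F : Type*) [Field F] (k : ℕ) (A : Finset F) : ℕ :=
  ∑ x ∈ A / A, repDiv F A A x ^ k

def mulEkbar (F : Type*) [Field F] (k : ℕ) (A : Finset F) : ℕ :=
  ⨆ s : F, mulEk F k (A.image fun a => a - s)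

/-- Number of points of `A × B` on the graph of `x ↦ l.1 * x + l.2`. -/
def nPts {F : Type*} [Field F] (A B : Finset F) (l : F × F) : ℕ :=
  ((A ×ˢ B).filter fun q => q.2 = l.1 * q.1 + l.2).card

/-- τ-rich lines of `𝓛`. -/
def Lrich {F : Type*} [Field F] (A B : Finset F) (L : Finset (F × F)) (τ : ℝ) : Finset (F × F) :=
  L.filter fun l => τ ≤ (nPts A B l : ℝ)

def affMap {F : Type*} [Field F] (l : F × F) : F → F := fun x => l.1 * x + l.2

def affInv {F : Type*} [Field F] (l : F × F) : F → F := fun x => (x - l.2) / l.1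

/-- alternating product `l₁ ∘ l₂⁻¹ ∘ l₃ ∘ l₄⁻¹ ∘ ⋯` in the affine group. -/
def altAff {F : Type*} [Field F] {k : ℕ} (a : Fin k → F × F) : F → F :=
  (List.ofFn fun i : Fin k => if (i : ℕ) % 2 = 0 then affMap (a i) else affInv (a i)).foldr
    (· ∘ ·) id

def TaffSet {F : Type*} [Field F] (k : ℕ) (L : Finset (F × F)) : ℕ :=
  (((Fintype.piFinset fun _ : Fin k => L) ×ˢ Fintype.piFinset fun _ : Fin k => L).filter
    fun q => altAff q.1 = altAff q.2).card

def affEnergy {F : Type*} [Field F] (L : Finset (F × F)) : ℕ :=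
  (((L ×ˢ L) ×ˢ L ×ˢ L).filter fun q =>
    affMap q.1.1 ∘ affInv q.1.2 = affMap q.2.1 ∘ affInv q.2.2).card

/-- incidences between `A × B` and the graphs of the maps in `L`. -/
def nInc {F : Type*} [Field F] (A B : Finset F) (L : Finset (F × F)) : ℕ :=
  (((A ×ˢ B) ×ˢ L).filter fun q => q.1.2 = q.2.1 * q.1.1 + q.2.2).card

/-- balanced function of `A ⊆ 𝔽_p`. -/
def balanced {p : ℕ} [NeZero p] (A : Finset (ZMod p)) : ZMod p → ℝ :=
  fun x => (if x ∈ A then 1 else 0) - (A.card : ℝ) / p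

def addEfun {p : ℕ} [NeZero p] (f : ZMod p → ℝ) : ℝ :=
  ∑ x, ∑ y, ∑ z, ∑ w, if x - y = z - w then f x * f y * f z * f w else 0

def mulEfun {p : ℕ} [NeZero p] (f : ZMod p → ℝ) : ℝ :=
  ∑ x, ∑ y, ∑ z, ∑ w, if x * w = z * y then f x * f y * f z * f w else 0

def mulEbarFun {p : ℕ} [NeZero p] (f : ZMod p → ℝ) : ℝ :=
  ⨆ s : ZMod p, mulEfun fun x => f (x + s)

/-- a line in the plane: `inl (a,b)` is `y = a x + b`, `inr c` is `x = c`. -/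
def onLine {F : Type*} [Field F] (l : (F × F) ⊕ F) (q : F × F) : Prop :=
  match l with
  | .inl ab => q.2 = ab.1 * q.1 + ab.2
  | .inr c => q.1 = c

def iLine {F : Type*} [Field F] (A B : Finset F) (l : (F × F) ⊕ F) : ℕ :=
  ((A ×ˢ B).filter fun q => onLine l q).card

def altSum {M : Type*} [AddCommGroup M] {k : ℕ} (x : Fin k → M) : M :=
  ∑ i : Fin k, if (i : ℕ) % 2 = 0 then x i else -x i

def TaddSet {M : Type*} [AddCommGroup M] (k : ℕ) (A : Finset M) : ℕ :=
  (((Fintype.piFinset fun _ : Fin k => A) ×ˢ Fintype.piFinset fun _ : Fin k => A).filter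
    fun q => altSum q.1 = altSum q.2).card

def TaddFun {p : ℕ} [NeZero p] (k : ℕ) (f : ZMod p → ℝ) : ℝ :=
  ∑ x : Fin k → ZMod p, ∑ y : Fin k → ZMod p,
    if altSum x = altSum y then (∏ i, f (x i)) * ∏ i, f (y i) else 0

def TaffFun {p : ℕ} [Fact p.Prime] (k : ℕ) (f : ZMod p × ZMod p → ℝ) : ℝ :=
  ∑ a ∈ Fintype.piFinset fun _ : Fin k => (Finset.univ.filter fun l : ZMod p × ZMod p => l.1 ≠ 0),
    ∑ b ∈ Fintype.piFinset fun _ : Fin k => (Finset.univ.filter fun l : ZMod p × ZMod p => l.1 ≠ 0),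
      if altAff a = altAff b then (∏ i, f (a i)) * ∏ i, f (b i) else 0

/-- `Ẽ^×_k (X, Y)`. -/
def tmulEk (F : Type*) [Field F] (k : ℕ) (X Y : Finset F) : ℕ :=
  (((Fintype.piFinset fun _ : Fin k => X.erase 0) ×ˢ
      Fintype.piFinset fun _ : Fin k => Y.erase 0).filter
    fun q => ∀ i j : Fin k, q.1 i * q.2 j = q.1 j * q.2 i).card

def addEkG {G : Type*} [AddCommGroup G] (k : ℕ) (A : Finset G) : ℕ :=
  ∑ x ∈ A - A, (((A ×ˢ A).filter fun q => q.1 - q.2 = x).card) ^ k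

end

theorem exists_continuous_median {ι : Type*} (Q : Finset ι) (hQ : Q.Nonempty) (f : ι → ℝ → ℝ)
    (hf : ∀ i, Continuous (f i)) :
    ∃ m : ℝ → ℝ, Continuous m ∧ ∀ t,
      2 * (Q.filter fun i => f i t < m t).card ≤ Q.card ∧
      Q.card ≤ 2 * (Q.filter fun i => f i t ≤ m t).card ∧ ∃ i ∈ Q, m t = f i t := by
  set h := (Q.card + 1) / 2 with hh
  have hQ1 : 1 ≤ Q.card := hQ.card_pos
  have hne : (Q.powersetCard h).Nonempty := Finset.powersetCard_nonempty.2 (by omega)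
  let F : Finset ι → ℝ → ℝ := fun S t => if hS : S.Nonempty then S.sup' hS (fun i => f i t) else 0
  have hS : ∀ S ∈ Q.powersetCard h, S.Nonempty := fun S hS =>
    Finset.card_pos.1 (by rw [(Finset.mem_powersetCard.1 hS).2]; omega)
  refine ⟨fun t => (Q.powersetCard h).inf' hne fun S => F S t, ?_, fun t => ⟨?_, ?_, ?_⟩⟩
  · refine Continuous.finset_inf'_apply hne fun S hS' => ?_
    simp only [F, hS S hS', dif_pos]
    exact Continuous.finset_sup'_apply _ fun i _ => hf i
  · by_contra! hc
    obtain ⟨S, hSs, hSc⟩ := Finset.exists_subset_card_eq (s := Q.filter fun i => f i t <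
      (Q.powersetCard h).inf' hne fun S => F S t) (n := h) (by omega)
    have hSm : S ∈ Q.powersetCard h :=
      Finset.mem_powersetCard.2 ⟨hSs.trans (Finset.filter_subset _ _), hSc⟩
    have h1 := Finset.inf'_le (fun S => F S t) hSm
    have h2 : F S t < (Q.powersetCard h).inf' hne fun S => F S t := by
      simp only [F, hS S hSm, dif_pos]
      rw [Finset.sup'_lt_iff]
      intro i hi
      exact (Finset.mem_filter.1 (hSs hi)).2
    exact absurd h1 (not_le.2 h2)
  · obtain ⟨S, hSm, hSe⟩ := Finset.exists_mem_eq_inf' hne fun S => F S t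
    obtain ⟨hSQ, hSc⟩ := Finset.mem_powersetCard.1 hSm
    have : S ⊆ Q.filter fun i => f i t ≤ (Q.powersetCard h).inf' hne fun S => F S t := by
      intro i hi
      refine Finset.mem_filter.2 ⟨hSQ hi, ?_⟩
      rw [hSe]
      simp only [F, hS S hSm, dif_pos]
      exact Finset.le_sup' (fun i => f i t) hi
    have := Finset.card_le_card this
    beta_reduce
    omega
  · obtain ⟨S, hSm, hSe⟩ := Finset.exists_mem_eq_inf' hne fun S => F S t
    simp only [hSe]
    simp only [F, hS S hSm, dif_pos]
    obtain ⟨i, hi, he⟩ := Finset.exists_mem_eq_sup' (hS S hSm) (fun i => f i t)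
    exact ⟨i, (Finset.mem_powersetCard.1 hSm).1 hi, he⟩

theorem exists_common_bisector (P R : Finset (ℝ × ℝ)) (hP : P.Nonempty) (hR : R.Nonempty)
    (hPR : ∀ p ∈ P, ∀ r ∈ R, p.1 < r.1) :
    ∃ t c : ℝ, (2 * (P.filter fun p => p.2 - t * p.1 < c).card ≤ P.card ∧
      P.card ≤ 2 * (P.filter fun p => p.2 - t * p.1 ≤ c).card) ∧
      2 * (R.filter fun p => p.2 - t * p.1 < c).card ≤ R.card ∧
      R.card ≤ 2 * (R.filter fun p => p.2 - t * p.1 ≤ c).card := by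
  have hc : ∀ p : ℝ × ℝ, Continuous fun t => p.2 - t * p.1 := fun p => by fun_prop
  obtain ⟨m, hm, hmP⟩ := exists_continuous_median P hP (fun p t => p.2 - t * p.1) hc
  obtain ⟨m', hm', hmR⟩ := exists_continuous_median R hR (fun p t => p.2 - t * p.1) hc
  set V := (P ×ˢ R).image fun q => (q.2.2 - q.1.2) / (q.2.1 - q.1.1) with hV
  obtain ⟨u, hu⟩ := V.bddAbove
  obtain ⟨l, hl⟩ := V.bddBelow
  have hslope : ∀ p ∈ P, ∀ r ∈ R, (r.2 - p.2) / (r.1 - p.1) ∈ V := fun p hp r hr =>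
    Finset.mem_image.2 ⟨(p, r), Finset.mem_product.2 ⟨hp, hr⟩, rfl⟩
  have h1 : m' u - m u ≤ 0 := by
    obtain ⟨-, -, p, hp, hpe⟩ := hmP u
    obtain ⟨-, -, r, hr, hre⟩ := hmR u
    have := hu (hslope p hp r hr)
    rw [div_le_iff₀ (by linarith [hPR p hp r hr])] at this
    rw [hpe, hre]; linarith
  have h2 : 0 ≤ m' l - m l := by
    obtain ⟨-, -, p, hp, hpe⟩ := hmP l
    obtain ⟨-, -, r, hr, hre⟩ := hmR l
    have := hl (hslope p hp r hr)
    rw [le_div_iff₀ (by linarith [hPR p hp r hr])] at this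
    rw [hpe, hre]; linarith
  obtain ⟨t, ht⟩ := mem_range_of_exists_le_of_exists_ge (c := (0 : ℝ)) (hm'.sub hm) ⟨u, h1⟩ ⟨l, h2⟩
  have ht' : m' t = m t := sub_eq_zero.1 ht
  refine ⟨t, m t, ⟨(hmP t).1, (hmP t).2.1⟩, ?_⟩
  rw [← ht']
  exact ⟨(hmR t).1, (hmR t).2.1⟩

/-- A set of which each line contains few points is split by two lines into four nearly equal
quadrants. -/
theorem exists_quadrants (Q : Finset (ℝ × ℝ)) (D : ℝ) (hD1 : 1 ≤ D) (hq : 96 * D ≤ Q.card)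
    (hD : ∀ α β γ : ℝ, (α ≠ 0 ∨ β ≠ 0) →
      ((Q.filter fun p => α * p.1 + β * p.2 = γ).card : ℝ) ≤ D) :
    ∃ x₀ t c : ℝ, ∀ χ : Bool × Bool,
      ((Q.filter fun p => (decide (p.1 < x₀), decide (p.2 - t * p.1 < c)) = χ).card : ℝ)
        ≤ Q.card / 4 + 2 * D := by
  have hQ : Q.Nonempty := Finset.card_pos.1 (by
    have : (0 : ℝ) < Q.card := by linarith
    exact_mod_cast this)
  obtain ⟨m, -, hm⟩ := exists_continuous_median Q hQ (fun p _ => p.1) (fun _ => continuous_const)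
  obtain ⟨h1, h2, -⟩ := hm 0
  set x₀ := m 0
  have split : ∀ (S : Finset (ℝ × ℝ)) (f : ℝ × ℝ → ℝ) (z : ℝ),
      ((S.filter fun p => f p = z).card : ℝ) ≤ D →
      2 * (S.filter fun p => f p < z).card ≤ S.card →
      S.card ≤ 2 * (S.filter fun p => f p ≤ z).card →
      ((S.filter fun p => f p < z).card : ℝ) ≤ S.card / 2 ∧
      ((S.filter fun p => ¬ f p < z).card : ℝ) ≤ S.card / 2 + D := by
    intro S f z h0 h1 h2
    have e1 := Finset.card_filter_add_card_filter_not (s := S) (fun p => f p < z)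
    have e2 : (S.filter fun p => f p ≤ z).card ≤
        (S.filter fun p => f p < z).card + (S.filter fun p => f p = z).card := by
      rw [← Finset.card_union_of_disjoint]
      · apply Finset.card_le_card
        intro p
        simp only [Finset.mem_filter, Finset.mem_union]
        rintro ⟨hp, hle⟩
        rcases hle.lt_or_eq with h | h <;> simp [hp, h]
      · rw [Finset.disjoint_filter]
        intro p _ hp hp'
        exact hp.ne hp'
    have e1' : ((S.filter fun p => f p < z).card : ℝ) + (S.filter fun p => ¬ f p < z).card
      = S.card := by exact_mod_cast e1
    have e2' : ((S.filter fun p => f p ≤ z).card : ℝ) ≤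
        (S.filter fun p => f p < z).card + (S.filter fun p => f p = z).card := by exact_mod_cast e2
    have h1' : 2 * ((S.filter fun p => f p < z).card : ℝ) ≤ S.card := by exact_mod_cast h1
    have h2' : (S.card : ℝ) ≤ 2 * (S.filter fun p => f p ≤ z).card := by exact_mod_cast h2
    constructor <;> linarith
  have hsub : ∀ (S : Finset (ℝ × ℝ)), S ⊆ Q → ∀ α β γ : ℝ, (α ≠ 0 ∨ β ≠ 0) →
      ((S.filter fun p => α * p.1 + β * p.2 = γ).card : ℝ) ≤ D := fun S hS α β γ h =>
    le_trans (by exact_mod_cast Finset.card_le_card (Finset.filter_subset_filter _ hS)) (hD α β γ h)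
  obtain ⟨hlt, hge⟩ := split Q (fun p => p.1) x₀
    (by simpa using hD 1 0 x₀ (by simp)) h1 h2
  have htot := Finset.card_filter_add_card_filter_not (s := Q) (fun p => p.1 < x₀)
  have htot' : ((Q.filter fun p => p.1 < x₀).card : ℝ) + (Q.filter fun p => ¬ p.1 < x₀).card
      = Q.card := by exact_mod_cast htot
  set P := Q.filter fun p => p.1 < x₀ with hP
  set R := Q.filter fun p => ¬ p.1 < x₀ with hR
  have hPne : P.Nonempty := Finset.card_pos.1 (by
    have : (0 : ℝ) < P.card := by linarith
    exact_mod_cast this)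
  have hRne : R.Nonempty := Finset.card_pos.1 (by
    have : (0 : ℝ) < R.card := by linarith
    exact_mod_cast this)
  obtain ⟨t, c, ⟨hP1, hP2⟩, hR1, hR2⟩ := exists_common_bisector P R hPne hRne (by
    intro p hp r hr
    have h1 := (Finset.mem_filter.1 hp).2
    have h2 := (Finset.mem_filter.1 hr).2
    linarith)
  have hline : ∀ S ⊆ Q, ((S.filter fun p => p.2 - t * p.1 = c).card : ℝ) ≤ D := by
    intro S hS
    have := hsub S hS (-t) 1 c (by simp)
    convert this using 5
    ring
  obtain ⟨a1, a2⟩ := split P (fun p => p.2 - t * p.1) c (hline P (Finset.filter_subset _ _)) hP1 hP2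
  obtain ⟨a3, a4⟩ := split R (fun p => p.2 - t * p.1) c (hline R (Finset.filter_subset _ _)) hR1 hR2
  refine ⟨x₀, t, c, ?_⟩
  rw [hP, Finset.filter_filter] at a1 a2
  rw [hR, Finset.filter_filter] at a3 a4
  rintro ⟨_ | _, _ | _⟩ <;> simp only [Prod.mk.injEq, decide_eq_true_eq, decide_eq_false_iff_not]
  all_goals linarith

theorem card_filter_same_eq_sum {α κ : Type*} [DecidableEq κ] (S : Finset α) (χ : α → κ)
    (T : Finset κ)
    (h : ∀ u ∈ S, χ u ∈ T) :
    ((S ×ˢ S).filter fun e => χ e.1 = χ e.2).card =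
      ∑ j ∈ T, (S.filter fun u => χ u = j).card ^ 2 := by
  rw [Finset.card_eq_sum_card_fiberwise (f := fun e => χ e.1) (t := T)]
  · refine Finset.sum_congr rfl fun j _ => ?_
    rw [sq, ← Finset.card_product]
    congr 1
    ext ⟨u, v⟩
    simp only [Finset.mem_filter, Finset.mem_product]
    constructor
    · rintro ⟨⟨⟨hu, hv⟩, h1⟩, h2⟩
      exact ⟨⟨hu, h2⟩, hv, h1 ▸ h2⟩
    · rintro ⟨⟨hu, h1⟩, hv, h2⟩
      exact ⟨⟨⟨hu, hv⟩, h1.trans h2.symm⟩, h1⟩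
  · intro e he
    simp only [Finset.coe_filter, Finset.mem_product, Set.mem_ofPred_eq] at he
    exact h _ he.1.1

theorem sq_card_le_card_mul_card_same {α κ : Type*} [DecidableEq κ] (S : Finset α) (χ : α → κ)
    (T : Finset κ)
    (h : ∀ u ∈ S, χ u ∈ T) :
    S.card ^ 2 ≤ T.card * ((S ×ˢ S).filter fun e => χ e.1 = χ e.2).card := by
  rw [card_filter_same_eq_sum S χ T h, Finset.card_eq_sum_card_fiberwise (f := χ) (t := T) h]
  exact sq_sum_le_card_mul_sum_sq

/-- The points `u`, `v`, `w` of the plane lie on a line. -/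
def Aligned (u v w : ℝ × ℝ) : Prop :=
  (v.1 - u.1) * (w.2 - u.2) = (v.2 - u.2) * (w.1 - u.1)

theorem Aligned.iff_of_aligned {u v u' v' : ℝ × ℝ} (huv : u ≠ v) (huv' : u' ≠ v')
    (hu : Aligned u v u') (hv : Aligned u v v') (w : ℝ × ℝ) :
    Aligned u' v' w ↔ Aligned u v w := by
  obtain ⟨u1, u2⟩ := u
  obtain ⟨v1, v2⟩ := v
  obtain ⟨x1, x2⟩ := u'
  obtain ⟨y1, y2⟩ := v'
  obtain ⟨w1, w2⟩ := w
  simp only [Aligned, ne_eq, Prod.mk.injEq, not_and_or] at *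
  obtain ⟨s, hs1, hs2⟩ : ∃ s, y1 - x1 = s * (v1 - u1) ∧ y2 - x2 = s * (v2 - u2) := by
    rcases huv with h | h
    · have h' : v1 - u1 ≠ 0 := sub_ne_zero.2 (Ne.symm h)
      refine ⟨(y1 - x1) / (v1 - u1), by field_simp, ?_⟩
      field_simp
      linear_combination hv - hu
    · have h' : v2 - u2 ≠ 0 := sub_ne_zero.2 (Ne.symm h)
      refine ⟨(y2 - x2) / (v2 - u2), ?_, by field_simp⟩
      field_simp
      linear_combination hu - hv
  have hs : s ≠ 0 := by
    rintro rfl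
    rcases huv' with h | h <;> apply h <;> linarith
  rw [hs1, hs2]
  constructor
  · intro h
    apply mul_left_cancel₀ hs
    linear_combination h + s * hu
  · intro h
    linear_combination s * h - s * hu

/-- A line misses one of the four quadrants determined by two crossing lines. -/
theorem exists_quadrant_not_mem (x₀ t c : ℝ) {u v : ℝ × ℝ} (huv : u ≠ v) :
    ∃ χ : Bool × Bool, ∀ w, Aligned u v w →
      (decide (w.1 < x₀), decide (w.2 - t * w.1 < c)) ≠ χ := by
  obtain ⟨u1, u2⟩ := u
  obtain ⟨v1, v2⟩ := v
  obtain ⟨α, β, γ, hαβ, hline⟩ : ∃ α β γ : ℝ, (α ≠ 0 ∨ β ≠ 0) ∧ ∀ w, Aligned (u1, u2) (v1, v2) w →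
      α * (w.1 - x₀) + β * (w.2 - t * w.1 - c) = γ := by
    refine ⟨-(v2 - u2) + t * (v1 - u1), v1 - u1, (-(v2 - u2) + t * (v1 - u1)) * (u1 - x₀) +
      (v1 - u1) * (u2 - t * u1 - c), ?_, ?_⟩
    · by_contra! h
      apply huv
      have h1 : v1 = u1 := by linarith [h.2]
      have h2 : v2 = u2 := by
        have := h.1
        rw [h.2] at this
        linarith
      rw [h1, h2]
    · intro w hw
      simp only [Aligned] at hw
      linear_combination hw
  by_contra! h
  obtain ⟨a, ha, ha'⟩ := h (true, true)
  obtain ⟨b, hb, hb'⟩ := h (true, false)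
  obtain ⟨d, hd, hd'⟩ := h (false, true)
  obtain ⟨e, he, he'⟩ := h (false, false)
  simp only [Prod.mk.injEq, decide_eq_true_eq, decide_eq_false_iff_not, not_lt] at ha' hb' hd' he'
  have ea := hline a ha
  have eb := hline b hb
  have ed := hline d hd
  have ee := hline e he
  have a1 : a.1 - x₀ < 0 := by linarith
  have a2 : a.2 - t * a.1 - c < 0 := by linarith
  have b1 : b.1 - x₀ < 0 := by linarith
  have b2 : 0 ≤ b.2 - t * b.1 - c := by linarith
  have d1 : 0 ≤ d.1 - x₀ := by linarith
  have d2 : d.2 - t * d.1 - c < 0 := by linarith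
  have e1 : 0 ≤ e.1 - x₀ := by linarith
  have e2 : 0 ≤ e.2 - t * e.1 - c := by linarith
  rcases le_total 0 α with hα | hα <;> rcases le_total 0 β with hβ | hβ
  all_goals
    rcases hαβ with h | h <;> rcases lt_or_gt_of_ne h with h' | h' <;>
    first
    | linarith
    | nlinarith

theorem card_sq_le_card_poor_pairs (Q : Finset (ℝ × ℝ)) (D : ℝ) (hD1 : 1 ≤ D)
    (hq : 96 * D ≤ Q.card)
    (hD : ∀ α β γ : ℝ, (α ≠ 0 ∨ β ≠ 0) →
      ((Q.filter fun p => α * p.1 + β * p.2 = γ).card : ℝ) ≤ D) :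
    (Q.card : ℝ) ^ 2 ≤
      10 * ((Q ×ˢ Q).filter fun e => e.1 ≠ e.2 ∧ (Q.filter (Aligned e.1 e.2)).card ≤ 48).card := by
  obtain ⟨x₀, t, c, hquad⟩ := exists_quadrants Q D hD1 hq hD
  set χ : ℝ × ℝ → Bool × Bool := fun p => (decide (p.1 < x₀), decide (p.2 - t * p.1 < c)) with hχ
  set line : (ℝ × ℝ) × (ℝ × ℝ) → Finset (ℝ × ℝ) := fun e => Q.filter (Aligned e.1 e.2) with hline
  set rich := (Q ×ˢ Q).filter fun e => e.1 ≠ e.2 ∧ ¬ (line e).card ≤ 48 with hrich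
  have hpoor : Q.card + ((Q ×ˢ Q).filter fun e => e.1 ≠ e.2 ∧ (line e).card ≤ 48).card + rich.card
      = Q.card ^ 2 := by
    have h1 := Finset.card_filter_add_card_filter_not (s := Q.offDiag) (fun e => (line e).card ≤ 48)
    have h2 : Q.offDiag = (Q ×ˢ Q).filter fun e => e.1 ≠ e.2 := by
      ext e; simp [Finset.mem_offDiag, and_assoc]
    have h3 := Finset.offDiag_card Q
    have h4 : Q.card ≤ Q.card * Q.card := Nat.le_mul_self _
    rw [h2, Finset.filter_filter, Finset.filter_filter, ← h2, h3] at h1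
    have h5 : rich.card = ((Q ×ˢ Q).filter fun e => e.1 ≠ e.2 ∧ ¬ (line e).card ≤ 48).card := rfl
    rw [sq, h5]
    simp only [ne_eq] at h1 ⊢
    omega
  have hsame : ((rich.filter fun e => χ e.1 = χ e.2).card : ℝ) ≤
      (Q.card / 4 + 2 * D) * Q.card := by
    have h1 : (rich.filter fun e => χ e.1 = χ e.2).card ≤
        ((Q ×ˢ Q).filter fun e => χ e.1 = χ e.2).card :=
      Finset.card_le_card (Finset.filter_subset_filter _ (Finset.filter_subset _ _))
    rw [card_filter_same_eq_sum Q χ Finset.univ (fun _ _ => Finset.mem_univ _)] at h1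
    calc ((rich.filter fun e => χ e.1 = χ e.2).card : ℝ)
        ≤ ∑ j, ((Q.filter fun u => χ u = j).card : ℝ) ^ 2 := by exact_mod_cast h1
      _ ≤ ∑ j, (Q.card / 4 + 2 * D) * ((Q.filter fun u => χ u = j).card : ℝ) := by
          refine Finset.sum_le_sum fun j _ => ?_
          rw [sq]
          exact mul_le_mul_of_nonneg_right (hquad j) (Nat.cast_nonneg _)
      _ = _ := by
          rw [← Finset.mul_sum]
          congr 1
          rw [Finset.card_eq_sum_card_fiberwise (f := χ) (t := Finset.univ) (s := Q)
            (fun _ _ => Finset.mem_univ _)]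
          push_cast
          rfl
  have hfib : ∀ e ∈ rich, rich.filter (fun e' => line e' = line e) = (line e).offDiag := by
    intro e he
    obtain ⟨heQ, hne, hc⟩ := Finset.mem_filter.1 he
    ext ⟨a, b⟩
    simp only [Finset.mem_filter, Finset.mem_offDiag, hrich, Finset.mem_product]
    constructor
    · rintro ⟨⟨⟨ha, hb⟩, hab, -⟩, hl⟩
      rw [← hl]
      refine ⟨?_, ?_, hab⟩
      · simp [hline, ha, Aligned]
      · simp [hline, hb, Aligned, mul_comm]
    · rintro ⟨ha, hb, hab⟩
      have ha' := Finset.mem_filter.1 ha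
      have hb' := Finset.mem_filter.1 hb
      have hl : line (a, b) = line e := by
        simp only [hline]
        refine Finset.filter_congr fun w _ => ?_
        exact Aligned.iff_of_aligned hne hab ha'.2 hb'.2 w
      refine ⟨⟨⟨ha'.1, hb'.1⟩, hab, ?_⟩, hl⟩
      rw [hl]
      exact hc
  have hmaps : ∀ e ∈ rich, line e ∈ rich.image line := fun e he => Finset.mem_image_of_mem _ he
  have hfrac : (15 / 48 : ℝ) * rich.card ≤ (rich.filter fun e => χ e.1 = χ e.2).card := by
    rw [Finset.card_eq_sum_card_fiberwise (f := line) (t := rich.image line) (s := rich) hmaps,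
      Finset.card_eq_sum_card_fiberwise (f := line) (t := rich.image line)
        (s := rich.filter fun e => χ e.1 = χ e.2)
        (fun e he => hmaps e (Finset.mem_filter.1 he).1)]
    push_cast
    rw [Finset.mul_sum]
    refine Finset.sum_le_sum fun S hS => ?_
    obtain ⟨e, he, rfl⟩ := Finset.mem_image.1 hS
    rw [Finset.filter_comm (fun e => χ e.1 = χ e.2) (fun e' => line e' = line e), hfib e he]
    obtain ⟨heQ, hne, hc⟩ := Finset.mem_filter.1 he
    obtain ⟨χ₀, hχ₀⟩ := exists_quadrant_not_mem x₀ t c hne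
    have h1 := sq_card_le_card_mul_card_same (line e) χ (Finset.univ.erase χ₀) (fun u hu =>
      Finset.mem_erase.2 ⟨hχ₀ u (Finset.mem_filter.1 hu).2, Finset.mem_univ _⟩)
    have h2 : (Finset.univ.erase χ₀).card = 3 := by
      rw [Finset.card_erase_of_mem (Finset.mem_univ _)]; rfl
    have h3 : ((line e ×ˢ line e).filter fun e => χ e.1 = χ e.2).card ≤
        ((line e).offDiag.filter fun e => χ e.1 = χ e.2).card + (line e).card := by
      rw [← Finset.diag_union_offDiag, Finset.filter_union]
      refine (Finset.card_union_le _ _).trans ?_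
      have := Finset.card_filter_le (line e).diag (fun e => χ e.1 = χ e.2)
      rw [Finset.diag_card] at this
      omega
    rw [h2] at h1
    have h4 : (line e).offDiag.card ≤ (line e).card ^ 2 := by
      rw [Finset.offDiag_card, sq]; omega
    have h5 : 48 ≤ (line e).card := by omega
    have h1' : ((line e).card : ℝ) ^ 2 ≤
        3 * ((line e ×ˢ line e).filter fun e => χ e.1 = χ e.2).card := by exact_mod_cast h1
    have h3' : (((line e ×ˢ line e).filter fun e => χ e.1 = χ e.2).card : ℝ) ≤
        ((line e).offDiag.filter fun e => χ e.1 = χ e.2).card + (line e).card := by exact_mod_cast h3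
    have h4' : ((line e).offDiag.card : ℝ) ≤ ((line e).card : ℝ) ^ 2 := by exact_mod_cast h4
    have h5' : (48 : ℝ) ≤ (line e).card := by exact_mod_cast h5
    nlinarith
  have hpoor' : (Q.card : ℝ) +
      ((Q ×ˢ Q).filter fun e => e.1 ≠ e.2 ∧ (line e).card ≤ 48).card + rich.card
      = (Q.card : ℝ) ^ 2 := by exact_mod_cast hpoor
  have hq1 : (96 : ℝ) ≤ Q.card := by linarith
  nlinarith

theorem aligned_of_mem_line {α β γ : ℝ} (h : α ≠ 0 ∨ β ≠ 0) {u v w : ℝ × ℝ}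
    (hu : α * u.1 + β * u.2 = γ) (hv : α * v.1 + β * v.2 = γ) (hw : α * w.1 + β * w.2 = γ) :
    Aligned u v w := by
  simp only [Aligned]
  rcases h with h | h
  · apply mul_left_cancel₀ h
    linear_combination (w.2 - u.2) * (hv - hu) - (v.2 - u.2) * (hw - hu)
  · apply mul_left_cancel₀ h
    linear_combination (v.1 - u.1) * (hw - hu) - (w.1 - u.1) * (hv - hu)

/-- The affine map `y ∘ u⁻¹ ∘ x`, where the pair `(a, b)` stands for `z ↦ a * z + b`. -/
noncomputable def affQuot (x y u : ℝ × ℝ) : ℝ × ℝ :=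
  (x.1 * y.1 / u.1, y.2 - y.1 / u.1 * (u.2 - x.2))

theorem affQuot_fst_mul {x y u : ℝ × ℝ} (hu : u.1 ≠ 0) : u.1 * (affQuot x y u).1 = x.1 * y.1 := by
  simp only [affQuot]; field_simp

theorem affQuot_affQuot {x y u : ℝ × ℝ} (hx : x.1 ≠ 0) (hu : u.1 ≠ 0) :
    affQuot u (affQuot x y u) x = y := by
  obtain ⟨y1, y2⟩ := y
  simp only [affQuot, Prod.mk.injEq]
  constructor
  · field_simp
  · field_simp
    ring

theorem aligned_of_affQuot_eq {x y x' y' u v w : ℝ × ℝ} (hxx : x ≠ x')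
    (hy : y.1 ≠ 0) (hu : u.1 ≠ 0) (hv : v.1 ≠ 0) (hw : w.1 ≠ 0)
    (eu : affQuot x y u = affQuot x' y' u) (ev : affQuot x y v = affQuot x' y' v)
    (ew : affQuot x y w = affQuot x' y' w) : Aligned u v w := by
  have h1 : x.1 * y.1 = x'.1 * y'.1 := by
    rw [← affQuot_fst_mul (x := x) (y := y) hu, eu, affQuot_fst_mul hu]
  have key : ∀ z : ℝ × ℝ, z.1 ≠ 0 → affQuot x y z = affQuot x' y' z →
      (y.2 - y'.2) * z.1 + (y'.1 - y.1) * z.2 = y'.1 * x'.2 - y.1 * x.2 := by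
    intro z hz h
    have h2 := congrArg Prod.snd h
    simp only [affQuot] at h2
    field_simp at h2
    linear_combination h2
  refine aligned_of_mem_line ?_ (key u hu eu) (key v hv ev) (key w hw ew)
  by_contra! hc
  have hy1 : y'.1 = y.1 := sub_eq_zero.1 hc.2
  have k := key u hu eu
  rw [hc.1, hc.2, hy1] at k
  rw [hy1] at h1
  apply hxx
  refine Prod.ext (mul_right_cancel₀ hy h1) (mul_left_cancel₀ hy ?_)
  linarith

/-- The number of solutions of `v = y ∘ u⁻¹ ∘ x` in a set of affine maps is small unless many of
the maps, viewed as points, lie on a line. -/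
theorem affine_energy_sq_le (L : Finset (ℝ × ℝ)) (hL : ∀ l ∈ L, l.1 ≠ 0) (D : ℝ)
    (hD : ∀ α β γ : ℝ, (α ≠ 0 ∨ β ≠ 0) →
      ((L.filter fun p => α * p.1 + β * p.2 = γ).card : ℝ) ≤ D) :
    (∑ p ∈ L ×ˢ L, ((L.filter fun u => affQuot p.1 p.2 u ∈ L).card : ℝ)) ^ 2 ≤
      20000 * D * (L.card : ℝ) ^ 5 := by
  rcases L.eq_empty_or_nonempty with rfl | ⟨l₀, hl₀⟩
  · simp
  have hD1 : 1 ≤ D := by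
    refine le_trans ?_ (hD 1 0 l₀.1 (by simp))
    have : 0 < (L.filter fun p => (1 : ℝ) * p.1 + 0 * p.2 = l₀.1).card :=
      Finset.card_pos.2 ⟨l₀, by simp [hl₀]⟩
    exact_mod_cast this
  set Q : (ℝ × ℝ) × (ℝ × ℝ) → Finset (ℝ × ℝ) := fun p => L.filter fun u => affQuot p.1 p.2 u ∈ L
    with hQ
  set poor : (ℝ × ℝ) × (ℝ × ℝ) → Finset ((ℝ × ℝ) × (ℝ × ℝ)) := fun p => (Q p ×ˢ Q p).filter
    fun e => e.1 ≠ e.2 ∧ ((Q p).filter (Aligned e.1 e.2)).card ≤ 48 with hpoor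
  set X : (ℝ × ℝ) × (ℝ × ℝ) → (ℝ × ℝ) × (ℝ × ℝ) → Finset (ℝ × ℝ) := fun g g' =>
    (Q g).filter fun x => affQuot g.1 g.2 x = affQuot g'.1 g'.2 x ∧
      (g.1, g'.1) ∈ poor (x, affQuot g.1 g.2 x) with hX
  set N : ℝ := (L.card : ℝ) with hN
  have hN0 : 0 ≤ N := Nat.cast_nonneg _
  set E : ℝ := ∑ p ∈ L ×ˢ L, ((Q p).card : ℝ) with hE
  set S : ℝ := ∑ p ∈ L ×ˢ L, ((Q p).card : ℝ) ^ 2 with hS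
  have hQN : ∀ p, ((Q p).card : ℝ) ≤ N := fun p => by
    rw [hN]
    exact Nat.cast_le.2 (Finset.card_le_card (Finset.filter_subset _ _))
  have hLL : ((L ×ˢ L).card : ℝ) = N ^ 2 := by rw [Finset.card_product]; push_cast; ring
  have hEN : E ≤ N ^ 3 := by
    calc E ≤ ∑ p ∈ L ×ˢ L, N := Finset.sum_le_sum fun p _ => hQN p
      _ = N ^ 3 := by rw [Finset.sum_const, nsmul_eq_mul, hLL]; ring
  have hE0 : 0 ≤ E := Finset.sum_nonneg fun _ _ => Nat.cast_nonneg _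
  have hS0 : 0 ≤ S := Finset.sum_nonneg fun _ _ => by positivity
  have hES : E ^ 2 ≤ N ^ 2 * S := by
    rw [← hLL]
    exact sq_sum_le_card_mul_sum_sq
  have hSpoor : S ≤ 96 * D * E + 10 * ∑ p ∈ L ×ˢ L, ((poor p).card : ℝ) := by
    rw [hS, hE, Finset.mul_sum, Finset.mul_sum, ← Finset.sum_add_distrib]
    refine Finset.sum_le_sum fun p _ => ?_
    rcases le_total (96 * D) (Q p).card with h | h
    · have h1 := card_sq_le_card_poor_pairs (Q p) D hD1 h (fun α β γ hαβ =>
        le_trans (Nat.cast_le.2 (Finset.card_le_card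
          (Finset.filter_subset_filter _ (Finset.filter_subset _ _)))) (hD α β γ hαβ))
      have : 0 ≤ 96 * D * (Q p).card := by positivity
      simp only [hpoor]
      linarith
    · have h1 : ((Q p).card : ℝ) ^ 2 ≤ 96 * D * (Q p).card := by
        rw [sq]
        exact mul_le_mul_of_nonneg_right h (Nat.cast_nonneg _)
      have : (0 : ℝ) ≤ (poor p).card := Nat.cast_nonneg _
      linarith
  have hpoorX : ∑ p ∈ L ×ˢ L, ((poor p).card : ℝ) ≤
      ∑ g ∈ L ×ˢ L, ∑ g' ∈ L ×ˢ L, ((X g g').card : ℝ) := by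
    rw [← Finset.sum_product']
    have h : ((L ×ˢ L).sigma poor).card ≤
        (((L ×ˢ L) ×ˢ (L ×ˢ L)).sigma fun e => X e.1 e.2).card := by
      refine Finset.card_le_card_of_injOn (fun a => ⟨((a.2.1, affQuot a.1.1 a.1.2 a.2.1),
        (a.2.2, affQuot a.1.1 a.1.2 a.2.2)), a.1.1⟩) ?_ ?_
      · rintro ⟨⟨x, y⟩, ⟨u, u'⟩⟩ ha
        simp only [Finset.coe_sigma, Set.mem_sigma_iff, Finset.mem_coe, Finset.mem_product] at ha ⊢
        obtain ⟨⟨hx, hy⟩, hp⟩ := ha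
        have hp' := hp
        simp only [hpoor, Finset.mem_filter, Finset.mem_product, hQ] at hp'
        obtain ⟨⟨⟨hu, hv⟩, hu', hv'⟩, -⟩ := hp'
        refine ⟨⟨⟨hu, hv⟩, hu', hv'⟩, ?_⟩
        simp only [hX, hQ, Finset.mem_filter]
        rw [affQuot_affQuot (hL x hx) (hL u hu), affQuot_affQuot (hL x hx) (hL u' hu')]
        exact ⟨⟨hx, hy⟩, rfl, hp⟩
      · rintro ⟨⟨x, y⟩, ⟨u, u'⟩⟩ ha ⟨⟨x2, y2⟩, ⟨w, w'⟩⟩ hb hab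
        simp only [Finset.coe_sigma, Set.mem_sigma_iff, Finset.mem_coe, Finset.mem_product,
          hpoor, Finset.mem_filter, hQ] at ha hb
        simp only [Sigma.mk.injEq, Prod.mk.injEq, heq_eq_eq] at hab
        obtain ⟨⟨⟨rfl, h1⟩, rfl, -⟩, rfl⟩ := hab
        have hy : y = y2 := by
          rw [← affQuot_affQuot (y := y) (hL x ha.1.1) (hL u ha.2.1.1.1), h1,
            affQuot_affQuot (hL x ha.1.1) (hL u ha.2.1.1.1)]
        rw [hy]
    rw [Finset.card_sigma, Finset.card_sigma] at h
    exact_mod_cast h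
  obtain ⟨J, hJ⟩ : ∃ J : (ℝ × ℝ) × (ℝ × ℝ) → (ℝ × ℝ) × (ℝ × ℝ) → ℝ,
      ∀ g g', J g g' = if (X g g').Nonempty then 1 else 0 := ⟨_, fun _ _ => rfl⟩
  have hXle : ∀ g g', ((X g g').card : ℝ) ≤
      960 * J g g' + ((X g g').offDiag.card : ℝ) / 960 := by
    intro g g'
    rw [hJ]
    split_ifs with h
    · have h1 : 1 ≤ (X g g').card := h.card_pos
      have h2 : ((X g g').offDiag.card : ℝ) = (X g g').card * (X g g').card - (X g g').card := by
        rw [Finset.offDiag_card, Nat.cast_sub (Nat.le_mul_self _)]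
        push_cast; rfl
      rw [h2]
      rcases le_or_gt (X g g').card 960 with h3 | h3
      · have h3' : ((X g g').card : ℝ) ≤ 960 := by exact_mod_cast h3
        have h1' : (1 : ℝ) ≤ (X g g').card := by exact_mod_cast h1
        nlinarith
      · have h3' : (961 : ℝ) ≤ (X g g').card := by exact_mod_cast h3
        nlinarith
    · rw [Finset.not_nonempty_iff_eq_empty.1 h]; simp
  have hne : ∑ g ∈ L ×ˢ L, ∑ g' ∈ L ×ˢ L, J g g' ≤
      D * N ^ 3 := by
    have h : ∀ g ∈ L ×ˢ L, ∀ u' ∈ L,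
        ∑ v' ∈ L, J g (u', v') ≤ D := by
      intro g hg u' hu'
      have hu0 : u'.1 ≠ 0 := hL u' hu'
      refine le_trans ?_ (hD 1 0 (g.1.1 * g.2.1 / u'.1) (by simp))
      simp only [hJ]
      rw [Finset.sum_boole]
      norm_cast
      refine Finset.card_le_card fun v' hv' => ?_
      obtain ⟨hv, x, hx⟩ := Finset.mem_filter.1 hv'
      simp only [hX, hQ, Finset.mem_filter] at hx
      have hx0 : x.1 ≠ 0 := hL x hx.1.1
      have h1 := congrArg Prod.fst hx.2.1
      simp only [affQuot] at h1
      refine Finset.mem_filter.2 ⟨hv, ?_⟩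
      field_simp at h1 ⊢
      linarith
    calc _ = ∑ g ∈ L ×ˢ L, ∑ u' ∈ L, ∑ v' ∈ L,
          J g (u', v') :=
          Finset.sum_congr rfl fun g _ => Finset.sum_product _ _ _
      _ ≤ ∑ g ∈ L ×ˢ L, ∑ u' ∈ L, D :=
          Finset.sum_le_sum fun g hg => Finset.sum_le_sum fun u' hu' => h g hg u' hu'
      _ = D * N ^ 3 := by
          simp only [Finset.sum_const, nsmul_eq_mul, hLL, ← hN]; ring
  have hoff : ∀ g ∈ L ×ˢ L, ∑ g' ∈ L ×ˢ L, ((X g g').offDiag.card : ℝ) ≤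
      48 * ((Q g).card : ℝ) ^ 2 := by
    rintro ⟨u, v⟩ hg
    obtain ⟨hu, hv⟩ := Finset.mem_product.1 hg
    have hsub : ∀ g', (X (u, v) g').offDiag.card =
        ∑ e ∈ Q (u, v) ×ˢ Q (u, v), if e ∈ (X (u, v) g').offDiag then 1 else 0 := by
      intro g'
      rw [← Finset.card_filter]
      congr 1
      ext e
      simp only [Finset.mem_filter, Finset.mem_product, Finset.mem_offDiag, hX]
      tauto
    have hcount : ∀ e ∈ Q (u, v) ×ˢ Q (u, v),
        ((L ×ˢ L).filter fun g' => e ∈ (X (u, v) g').offDiag).card ≤ 48 := by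
      rintro ⟨x, x'⟩ he
      rcases Finset.eq_empty_or_nonempty
        ((L ×ˢ L).filter fun g' => (x, x') ∈ (X (u, v) g').offDiag) with h0 | ⟨⟨u₀, v₀⟩, h0⟩
      · rw [h0]; simp
      simp only [Finset.mem_filter, Finset.mem_product, Finset.mem_offDiag, hX, hQ] at h0 he
      obtain ⟨⟨hu₀, hv₀⟩, ⟨-, ex, hp⟩, ⟨-, ex', -⟩, hxx⟩ := h0
      obtain ⟨⟨hx, hy⟩, hx', hy'⟩ := he
      set y := affQuot u v x with hyd
      set y' := affQuot u v x' with hyd'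
      simp only [hpoor, Finset.mem_filter] at hp
      refine le_trans (Finset.card_le_card_of_injOn (fun g' => g'.1) ?_ ?_) hp.2.2
      · rintro ⟨w, z⟩ hw
        simp only [Finset.mem_coe, Finset.mem_filter, Finset.mem_product, Finset.mem_offDiag, hX,
          hQ] at hw ⊢
        obtain ⟨⟨hw, hz⟩, ⟨-, fx, fp⟩, ⟨-, fx', -⟩, -⟩ := hw
        rw [← hyd] at fx
        rw [← hyd'] at fx'
        have hzx : affQuot x y w = z := by rw [fx, affQuot_affQuot (hL w hw) (hL x hx)]
        refine ⟨⟨hw, by rw [hzx]; exact hz⟩, ?_⟩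
        refine aligned_of_affQuot_eq (y' := y') hxx (hL y hy) (hL u hu) (hL u₀ hu₀) (hL w hw) ?_ ?_ ?_
        · rw [hyd, hyd', affQuot_affQuot (hL u hu) (hL x hx), affQuot_affQuot (hL u hu) (hL x' hx')]
        · rw [ex, ex', affQuot_affQuot (hL u₀ hu₀) (hL x hx),
            affQuot_affQuot (hL u₀ hu₀) (hL x' hx')]
        · rw [fx, fx', affQuot_affQuot (hL w hw) (hL x hx), affQuot_affQuot (hL w hw) (hL x' hx')]
      · rintro ⟨w, z⟩ hw ⟨w', z'⟩ hw' h
        simp only [Finset.mem_coe, Finset.mem_filter, Finset.mem_product, Finset.mem_offDiag, hX,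
          hQ] at hw hw' h
        subst h
        have e1 := hw.2.1.2.1
        rw [hw'.2.1.2.1] at e1
        have e2 : z' = z := by
          rw [← affQuot_affQuot (y := z') (hL w hw.1.1) (hL x hx), e1,
            affQuot_affQuot (hL w hw.1.1) (hL x hx)]
        rw [e2]
    have : ∑ g' ∈ L ×ˢ L, (X (u, v) g').offDiag.card ≤ 48 * (Q (u, v)).card ^ 2 := by
      rw [Finset.sum_congr rfl fun g' _ => hsub g', Finset.sum_comm]
      calc _ ≤ ∑ e ∈ Q (u, v) ×ˢ Q (u, v), 48 := by
            refine Finset.sum_le_sum fun e he => ?_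
            rw [← Finset.card_filter]
            exact hcount e he
        _ = _ := by rw [Finset.sum_const, Finset.card_product, smul_eq_mul]; ring
    exact_mod_cast this
  have hZ : ∑ p ∈ L ×ˢ L, ((poor p).card : ℝ) ≤ 960 * (D * N ^ 3) + S / 20 := by
    calc _ ≤ _ := hpoorX
      _ ≤ ∑ g ∈ L ×ˢ L, ∑ g' ∈ L ×ˢ L, (960 * J g g' +
          ((X g g').offDiag.card : ℝ) / 960) :=
          Finset.sum_le_sum fun g _ => Finset.sum_le_sum fun g' _ => hXle g g'
      _ = 960 * ∑ g ∈ L ×ˢ L, ∑ g' ∈ L ×ˢ L, J g g' +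
          (∑ g ∈ L ×ˢ L, ∑ g' ∈ L ×ˢ L, ((X g g').offDiag.card : ℝ)) / 960 := by
          simp only [Finset.sum_add_distrib, Finset.mul_sum, Finset.sum_div]
      _ ≤ 960 * (D * N ^ 3) + (∑ g ∈ L ×ˢ L, 48 * ((Q g).card : ℝ) ^ 2) / 960 := by
          gcongr with g hg
          exact hoff g hg
      _ = _ := by rw [← Finset.mul_sum]; ring
  have h96 : D * E ≤ D * N ^ 3 := by gcongr
  have hSle : S ≤ 20000 * (D * N ^ 3) := by
    have : 0 ≤ D * N ^ 3 := by positivity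
    linarith
  calc E ^ 2 ≤ N ^ 2 * S := hES
    _ ≤ N ^ 2 * (20000 * (D * N ^ 3)) := by gcongr
    _ = _ := by ring

theorem nPts_le_card (A : Finset ℝ) (l : ℝ × ℝ) : nPts A A l ≤ A.card := by
  refine Finset.card_le_card_of_injOn Prod.fst ?_ ?_
  · intro p hp
    exact (Finset.mem_product.1 (Finset.mem_filter.1 hp).1).1
  · rintro ⟨x, y⟩ hp ⟨x', y'⟩ hq (rfl : x = x')
    have h1 := (Finset.mem_filter.1 hp).2
    have h2 := (Finset.mem_filter.1 hq).2
    simp only at h1 h2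
    rw [h1, h2]

/-- Two distinct points lie on at most one non-vertical line. -/
theorem line_unique {u v l m : ℝ × ℝ} (huv : u ≠ v)
    (hu : u.2 = l.1 * u.1 + l.2) (hv : v.2 = l.1 * v.1 + l.2)
    (hu' : u.2 = m.1 * u.1 + m.2) (hv' : v.2 = m.1 * v.1 + m.2) : l = m := by
  have hx : u.1 - v.1 ≠ 0 := by
    intro h
    have h1 : u.1 = v.1 := sub_eq_zero.1 h
    exact huv (Prod.ext h1 (by rw [hu, hv, h1]))
  have h1 : l.1 = m.1 := by
    apply mul_right_cancel₀ hx
    linear_combination -hu + hv + hu' - hv'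
  refine Prod.ext h1 ?_
  rw [h1] at hu
  linarith

/-- A finite set of reals splits into `r` intervals of at most `s` elements each. -/
theorem exists_monotone_coloring (A : Finset ℝ) {r s : ℕ} (h : A.card ≤ r * s) :
    ∃ col : ℝ → ℕ, Monotone col ∧ (∀ x ∈ A, col x < r) ∧
      ∀ j, (A.filter fun x => col x = j).card ≤ s := by
  rcases Nat.eq_zero_or_pos s with rfl | hs
  · have hA : A = ∅ := by simpa using h
    subst hA
    exact ⟨fun _ => 0, fun _ _ _ => le_rfl, by simp, by simp⟩
  have hrank : ∀ {x y : ℝ}, x ∈ A → x < y →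
      (A.filter (· < x)).card < (A.filter (· < y)).card := by
    intro x y hx hxy
    refine Finset.card_lt_card (Finset.ssubset_iff_of_subset ?_ |>.2 ⟨x, ?_, ?_⟩)
    · intro a ha
      simp only [Finset.mem_filter] at ha ⊢
      exact ⟨ha.1, ha.2.trans hxy⟩
    · simp [hx, hxy]
    · simp
  refine ⟨fun x => (A.filter (· < x)).card / s, ?_, ?_, ?_⟩
  · intro x y hxy
    refine Nat.div_le_div_right (Finset.card_le_card fun a ha => ?_)
    simp only [Finset.mem_filter] at ha ⊢
    exact ⟨ha.1, ha.2.trans_le hxy⟩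
  · intro x hx
    rw [Nat.div_lt_iff_lt_mul hs]
    refine lt_of_lt_of_le (Finset.card_lt_card ?_) h
    exact Finset.filter_ssubset.2 ⟨x, hx, lt_irrefl _⟩
  · intro j
    have : (Finset.Ico (j * s) (j * s + s)).card = s := by simp
    refine le_trans (Finset.card_le_card_of_injOn (fun x => (A.filter (· < x)).card) ?_ ?_) this.le
    · intro x hx
      have h1 := (Finset.mem_filter.1 hx).2
      rw [Nat.div_eq_iff hs] at h1
      simp only [Finset.coe_Ico, Set.mem_Ico]
      omega
    · intro x hx y hy hxy
      have hx' := (Finset.mem_filter.1 hx).1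
      have hy' := (Finset.mem_filter.1 hy).1
      rcases lt_trichotomy x y with h' | h' | h'
      · exact absurd hxy (hrank hx' h').ne
      · exact h'
      · exact absurd hxy (hrank hy' h').ne'

/-- Szemerédi–Trotter type bound for the lines rich in points of `A × A`. -/
theorem mul_sum_nPts_sq_le (A : Finset ℝ) (L : Finset (ℝ × ℝ)) (hL : ∀ l ∈ L, l.1 ≠ 0) {r : ℕ}
    (hr : 1 ≤ r) (hrich : ∀ l ∈ L, 4 * r ≤ nPts A A l) :
    r * ∑ l ∈ L, nPts A A l ^ 2 ≤ 16 * A.card ^ 4 := by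
  rcases L.eq_empty_or_nonempty with rfl | ⟨l₀, hl₀⟩
  · simp
  have hrn : 4 * r ≤ A.card := (hrich l₀ hl₀).trans (nPts_le_card A l₀)
  set n := A.card with hn
  set s := n / r + 1 with hs
  have hrs : n ≤ r * s := by
    have := Nat.lt_mul_div_succ n hr
    exact this.le
  have hrs' : r * s ≤ 2 * n := by
    have := Nat.mul_div_le n r
    rw [hs, mul_add]
    omega
  obtain ⟨col, hmono, hlt, hfib⟩ := exists_monotone_coloring A hrs
  set P := ((A ×ˢ A) ×ˢ (A ×ˢ A)).filter fun e => e.1 ≠ e.2 ∧ col e.1.1 = col e.2.1 ∧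
    col e.1.2 = col e.2.2 with hP
  set S : ℝ × ℝ → Finset (ℝ × ℝ) := fun l => (A ×ˢ A).filter fun q => q.2 = l.1 * q.1 + l.2 with hS
  set O : ℝ × ℝ → Finset ((ℝ × ℝ) × (ℝ × ℝ)) := fun l => P.filter fun e => e.1 ∈ S l ∧ e.2 ∈ S l
    with hO
  have hPcard : P.card ≤ n ^ 2 * s ^ 2 := by
    have h1 : P ⊆ (A ×ˢ A).biUnion fun u => (((A.filter fun x => col x = col u.1) ×ˢ
        (A.filter fun y => col y = col u.2)).image fun v => (u, v)) := by
      rintro ⟨u, v⟩ he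
      simp only [hP, Finset.mem_filter, Finset.mem_product] at he
      simp only [Finset.mem_biUnion, Finset.mem_product, Finset.mem_image, Finset.mem_filter]
      exact ⟨u, he.1.1, v, ⟨⟨he.1.2.1, he.2.2.1.symm⟩, he.1.2.2, he.2.2.2.symm⟩, rfl⟩
    refine (Finset.card_le_card h1).trans ((Finset.card_biUnion_le_card_mul _ _ (s ^ 2) ?_).trans ?_)
    · intro u _
      refine Finset.card_image_le.trans ?_
      rw [Finset.card_product, sq]
      exact Nat.mul_le_mul (hfib _) (hfib _)
    · rw [Finset.card_product, ← sq]
  have hsum : ∑ l ∈ L, (O l).card ≤ P.card := by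
    rw [← Finset.card_biUnion]
    · exact Finset.card_le_card (Finset.biUnion_subset.2 fun l _ => Finset.filter_subset _ _)
    · intro l _ m _ hlm
      refine Finset.disjoint_left.2 fun e hl hm => hlm ?_
      simp only [hO, hP, hS, Finset.mem_filter] at hl hm
      exact line_unique hl.1.2.1 hl.2.1.2 hl.2.2.2 hm.2.1.2 hm.2.2.2
  have hline : ∀ l ∈ L, nPts A A l ^ 2 ≤ 4 * r * (O l).card := by
    intro l hl
    have hl0 := hL l hl
    obtain ⟨χ, hχ, hχ'⟩ : ∃ χ : ℝ × ℝ → ℕ, (∀ u ∈ S l, χ u ∈ Finset.range (2 * r)) ∧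
        ∀ u ∈ S l, ∀ v ∈ S l, u.1 ≤ v.1 → χ u = χ v → col u.1 = col v.1 ∧ col u.2 = col v.2 := by
      have hmem : ∀ u ∈ S l, (col u.1 < r ∧ col u.2 < r) ∧ u.2 = l.1 * u.1 + l.2 := by
        intro u hu
        simp only [hS, Finset.mem_filter, Finset.mem_product] at hu
        exact ⟨⟨hlt _ hu.1.1, hlt _ hu.1.2⟩, hu.2⟩
      rcases lt_or_gt_of_ne hl0 with hneg | hpos
      · refine ⟨fun u => col u.1 + (r - 1 - col u.2), fun u hu => ?_, fun u hu v hv huv h => ?_⟩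
        · have := hmem u hu
          rw [Finset.mem_range]
          dsimp only
          omega
        · obtain ⟨⟨a1, a2⟩, a3⟩ := hmem u hu
          obtain ⟨⟨b1, b2⟩, b3⟩ := hmem v hv
          have h1 := hmono huv
          have h2 : col v.2 ≤ col u.2 := hmono (by rw [a3, b3]; nlinarith)
          simp only at h
          omega
      · refine ⟨fun u => col u.1 + col u.2, fun u hu => ?_, fun u hu v hv huv h => ?_⟩
        · have := hmem u hu
          rw [Finset.mem_range]
          dsimp only
          omega
        · obtain ⟨⟨a1, a2⟩, a3⟩ := hmem u hu
          obtain ⟨⟨b1, b2⟩, b3⟩ := hmem v hv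
          have h1 := hmono huv
          have h2 : col u.2 ≤ col v.2 := hmono (by rw [a3, b3]; nlinarith)
          simp only at h
          omega
    have h1 := sq_card_le_card_mul_card_same (S l) χ (Finset.range (2 * r)) hχ
    have h2 : ((S l ×ˢ S l).filter fun e => χ e.1 = χ e.2) ⊆ O l ∪ (S l).diag := by
      rintro ⟨u, v⟩ he
      simp only [Finset.mem_filter, Finset.mem_product] at he
      obtain ⟨⟨hu, hv⟩, he⟩ := he
      rw [Finset.mem_union, Finset.mem_diag]
      by_cases huv : u = v
      · exact Or.inr ⟨hu, huv⟩
      · left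
        have h3 : col u.1 = col v.1 ∧ col u.2 = col v.2 := by
          rcases le_total u.1 v.1 with h | h
          · exact hχ' u hu v hv h he
          · have := hχ' v hv u hu h he.symm
            exact ⟨this.1.symm, this.2.symm⟩
        exact Finset.mem_filter.2 ⟨Finset.mem_filter.2 ⟨Finset.mem_product.2
          ⟨(Finset.mem_filter.1 hu).1, (Finset.mem_filter.1 hv).1⟩, huv, h3⟩, hu, hv⟩
    have h4 := (Finset.card_le_card h2).trans (Finset.card_union_le _ _)
    rw [Finset.diag_card] at h4
    have h5 : (S l).card = nPts A A l := rfl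
    have h6 := hrich l hl
    rw [Finset.card_range, h5] at h1
    rw [h5] at h4
    have h7 := h1.trans (Nat.mul_le_mul_left (2 * r) h4)
    have h8 : 4 * r * nPts A A l ≤ nPts A A l ^ 2 := by
      rw [sq]; exact Nat.mul_le_mul_right _ h6
    nlinarith
  calc r * ∑ l ∈ L, nPts A A l ^ 2 ≤ r * ∑ l ∈ L, 4 * r * (O l).card :=
        Nat.mul_le_mul_left _ (Finset.sum_le_sum hline)
    _ = 4 * r ^ 2 * ∑ l ∈ L, (O l).card := by rw [← Finset.mul_sum]; ring
    _ ≤ 4 * r ^ 2 * (n ^ 2 * s ^ 2) := Nat.mul_le_mul_left _ (hsum.trans hPcard)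
    _ = 4 * n ^ 2 * (r * s) ^ 2 := by ring
    _ ≤ 4 * n ^ 2 * (2 * n) ^ 2 := Nat.mul_le_mul_left _ (Nat.pow_le_pow_left hrs' 2)
    _ = 16 * n ^ 4 := by ring

/-- The lines that are not parallel to an axis and pass through two points of `A × A`. -/
noncomputable def richLines (A : Finset ℝ) : Finset (ℝ × ℝ) :=
  (((A ×ˢ A) ×ˢ (A ×ˢ A)).image fun e => ((e.1.2 - e.2.2) / (e.1.1 - e.2.1),
    e.1.2 - (e.1.2 - e.2.2) / (e.1.1 - e.2.1) * e.1.1)).filter fun l => l.1 ≠ 0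

theorem card_richLines_le (A : Finset ℝ) : (richLines A).card ≤ A.card ^ 4 := by
  refine (Finset.card_filter_le _ _).trans (Finset.card_image_le.trans ?_)
  simp only [Finset.card_product]
  exact le_of_eq (by ring)

theorem mem_richLines {A : Finset ℝ} {l u v : ℝ × ℝ} (hl : l.1 ≠ 0) (huv : u.1 ≠ v.1)
    (hu : u ∈ A ×ˢ A) (hv : v ∈ A ×ˢ A) (hul : u.2 = l.1 * u.1 + l.2)
    (hvl : v.2 = l.1 * v.1 + l.2) : l ∈ richLines A := by
  have h0 : u.1 - v.1 ≠ 0 := sub_ne_zero.2 huv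
  have h1 : (u.2 - v.2) / (u.1 - v.1) = l.1 := by
    rw [div_eq_iff h0]; linear_combination hul - hvl
  refine Finset.mem_filter.2 ⟨Finset.mem_image.2 ⟨(u, v), Finset.mem_product.2 ⟨hu, hv⟩, ?_⟩, hl⟩
  simp only [h1]
  exact Prod.ext rfl (by simp only; linarith)

/-- The lines not parallel to an axis that contain at least `k` points of `A × A`. -/
noncomputable def kRich (A : Finset ℝ) (k : ℕ) : Finset (ℝ × ℝ) :=
  (richLines A).filter fun l => k ≤ nPts A A l

theorem fst_ne_zero_of_mem_kRich {A : Finset ℝ} {k : ℕ} {l : ℝ × ℝ} (h : l ∈ kRich A k) :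
    l.1 ≠ 0 :=
  (Finset.mem_filter.1 (Finset.mem_filter.1 h).1).2

theorem le_nPts_of_mem_kRich {A : Finset ℝ} {k : ℕ} {l : ℝ × ℝ} (h : l ∈ kRich A k) :
    k ≤ nPts A A l :=
  (Finset.mem_filter.1 h).2

theorem pow_three_mul_card_kRich_le (A : Finset ℝ) (k : ℕ) :
    k ^ 3 * (kRich A k).card ≤ 112 * A.card ^ 4 := by
  rcases lt_or_ge k 4 with hk | hk
  · have h1 : k ^ 3 ≤ 3 ^ 3 := Nat.pow_le_pow_left (by omega) 3
    calc k ^ 3 * (kRich A k).card ≤ 3 ^ 3 * A.card ^ 4 :=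
          Nat.mul_le_mul h1 ((Finset.card_filter_le _ _).trans (card_richLines_le A))
      _ ≤ _ := Nat.mul_le_mul_right _ (by norm_num)
  · have h1 := mul_sum_nPts_sq_le A (kRich A k) (fun _ => fst_ne_zero_of_mem_kRich) (r := k / 4)
      (by omega) (fun l hl => le_trans (by omega) (le_nPts_of_mem_kRich hl))
    have h2 : (kRich A k).card * k ^ 2 ≤ ∑ l ∈ kRich A k, nPts A A l ^ 2 := by
      rw [← smul_eq_mul]
      exact Finset.card_nsmul_le_sum _ _ _ fun l hl =>
        Nat.pow_le_pow_left (le_nPts_of_mem_kRich hl) 2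
    have h3 : k ≤ 7 * (k / 4) := by omega
    calc k ^ 3 * (kRich A k).card = k * ((kRich A k).card * k ^ 2) := by ring
      _ ≤ 7 * (k / 4) * ∑ l ∈ kRich A k, nPts A A l ^ 2 := Nat.mul_le_mul h3 h2
      _ = 7 * (k / 4 * ∑ l ∈ kRich A k, nPts A A l ^ 2) := by ring
      _ ≤ 7 * (16 * A.card ^ 4) := Nat.mul_le_mul_left _ h1
      _ = _ := by ring

theorem collinear_range_cases {A : Finset ℝ} {f : Fin 4 → ℝ × ℝ} (hf : ∀ i, f i ∈ A ×ˢ A)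
    (h : Collinear ℝ (Set.range f)) :
    (∀ i, (f i).1 = (f 0).1) ∨ (∀ i, (f i).2 = (f 0).2) ∨
      ∃ l ∈ richLines A, ∀ i, (f i).2 = l.1 * (f i).1 + l.2 := by
  rw [collinear_iff_of_mem (Set.mem_range_self (f := f) 0)] at h
  obtain ⟨v, hv⟩ := h
  have hv' : ∀ i, ∃ t : ℝ, (f i).1 = t * v.1 + (f 0).1 ∧ (f i).2 = t * v.2 + (f 0).2 := by
    intro i
    obtain ⟨t, ht⟩ := hv (f i) ⟨i, rfl⟩
    exact ⟨t, by rw [ht]; simp, by rw [ht]; simp⟩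
  by_cases h1 : ∀ i, (f i).1 = (f 0).1
  · exact Or.inl h1
  by_cases h2 : v.2 = 0
  · right; left
    intro i
    obtain ⟨t, -, ht⟩ := hv' i
    rw [ht, h2]; ring
  right; right
  push Not at h1
  obtain ⟨j, hj⟩ := h1
  have h3 : v.1 ≠ 0 := by
    intro h3
    obtain ⟨t, ht, -⟩ := hv' j
    rw [h3] at ht
    apply hj
    rw [ht]; ring
  have h4 : ∀ i, (f i).2 = v.2 / v.1 * (f i).1 + ((f 0).2 - v.2 / v.1 * (f 0).1) := by
    intro i
    obtain ⟨t, ht, ht'⟩ := hv' i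
    rw [ht, ht']
    field_simp
    ring
  exact ⟨(v.2 / v.1, (f 0).2 - v.2 / v.1 * (f 0).1),
    mem_richLines (div_ne_zero h2 h3) hj (hf j) (hf 0) (h4 j) (h4 0), h4⟩

theorem pow_four_le_sum (m : ℕ) : m ^ 4 ≤ ∑ k ∈ Finset.range m, 4 * (k + 1) ^ 3 := by
  induction m with
  | zero => simp
  | succ m ih =>
    rw [Finset.sum_range_succ]
    nlinarith [ih, Nat.zero_le (m ^ 3), Nat.zero_le (m ^ 2)]

theorem Ctuples_four_le (A : Finset ℝ) :
    Ctuples ℝ 4 A A ≤ 2 * A.card ^ 5 +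
      ∑ k ∈ Finset.range A.card, 4 * (k + 1) ^ 3 * (kRich A (k + 1)).card := by
  set S : ℝ × ℝ → Finset (ℝ × ℝ) := fun l => (A ×ˢ A).filter fun q => q.2 = l.1 * q.1 + l.2 with hS
  set V : Finset (Fin 4 → ℝ × ℝ) := (A ×ˢ Fintype.piFinset fun _ : Fin 4 => A).image
    fun p i => (p.1, p.2 i) with hV
  set H : Finset (Fin 4 → ℝ × ℝ) := (A ×ˢ Fintype.piFinset fun _ : Fin 4 => A).image
    fun p i => (p.2 i, p.1) with hH
  set R : Finset (Fin 4 → ℝ × ℝ) := (richLines A).biUnion fun l => Fintype.piFinset fun _ => S l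
    with hR
  have hcard : (A ×ˢ Fintype.piFinset fun _ : Fin 4 => A).card = A.card ^ 5 := by
    rw [Finset.card_product, Fintype.card_piFinset_const]; ring
  have hsub : ((Fintype.piFinset fun _ : Fin 4 => A ×ˢ A).filter
      fun f => Collinear ℝ (Set.range f)) ⊆ V ∪ H ∪ R := by
    intro f hf
    simp only [Finset.mem_filter, Fintype.mem_piFinset] at hf
    obtain ⟨hf, hc⟩ := hf
    have hf' := fun i => Finset.mem_product.1 (hf i)
    simp only [Finset.mem_union, hV, hH, hR, Finset.mem_image, Finset.mem_biUnion,
      Fintype.mem_piFinset, Finset.mem_product]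
    rcases collinear_range_cases hf hc with h | h | ⟨l, hl, h⟩
    · exact Or.inl (Or.inl ⟨((f 0).1, fun i => (f i).2), ⟨(hf' 0).1, fun i => (hf' i).2⟩,
        funext fun i => Prod.ext (h i).symm rfl⟩)
    · exact Or.inl (Or.inr ⟨((f 0).2, fun i => (f i).1), ⟨(hf' 0).2, fun i => (hf' i).1⟩,
        funext fun i => Prod.ext rfl (h i).symm⟩)
    · exact Or.inr ⟨l, hl, fun i => Finset.mem_filter.2 ⟨hf i, h i⟩⟩
  have hRle : R.card ≤ ∑ k ∈ Finset.range A.card, 4 * (k + 1) ^ 3 * (kRich A (k + 1)).card := by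
    calc R.card ≤ ∑ l ∈ richLines A, nPts A A l ^ 4 := by
          refine Finset.card_biUnion_le.trans (Finset.sum_le_sum fun l _ => ?_)
          rw [Fintype.card_piFinset_const]
          exact le_rfl
      _ ≤ ∑ l ∈ richLines A, ∑ k ∈ Finset.range A.card,
            if k + 1 ≤ nPts A A l then 4 * (k + 1) ^ 3 else 0 := by
          refine Finset.sum_le_sum fun l _ => (pow_four_le_sum _).trans ?_
          rw [← Finset.sum_filter]
          refine Finset.sum_le_sum_of_subset fun k hk => ?_
          rw [Finset.mem_range] at hk
          exact Finset.mem_filter.2 ⟨Finset.mem_range.2 (hk.trans_le (nPts_le_card A l)), hk⟩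
      _ = _ := by
          rw [Finset.sum_comm]
          refine Finset.sum_congr rfl fun k _ => ?_
          rw [← Finset.sum_filter, Finset.sum_const, smul_eq_mul, mul_comm]
          rfl
  have h1 : V.card ≤ A.card ^ 5 := hcard ▸ Finset.card_image_le
  have h2 : H.card ≤ A.card ^ 5 := hcard ▸ Finset.card_image_le
  have h3 := (Finset.card_le_card hsub).trans ((Finset.card_union_le _ _).trans
    (Nat.add_le_add_right (Finset.card_union_le _ _) _))
  have h4 : Ctuples ℝ 4 A A = ((Fintype.piFinset fun _ : Fin 4 => A ×ˢ A).filter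
      fun f => Collinear ℝ (Set.range f)).card := rfl
  omega

theorem two_mul_card_eq_le {α β κ : Type*} [DecidableEq κ] (X : Finset α) (Y : Finset β)
    (f : α → κ) (g : β → κ) :
    2 * ((X ×ˢ Y).filter fun e => f e.1 = g e.2).card ≤
      ((X ×ˢ X).filter fun e => f e.1 = f e.2).card +
      ((Y ×ˢ Y).filter fun e => g e.1 = g e.2).card := by
  set T := X.image f ∪ Y.image g with hT
  have hf : ∀ u ∈ X, f u ∈ T := fun u hu =>
    Finset.mem_union_left _ (Finset.mem_image_of_mem f hu)
  have hg : ∀ u ∈ Y, g u ∈ T := fun u hu =>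
    Finset.mem_union_right _ (Finset.mem_image_of_mem g hu)
  have h1 : ((X ×ˢ Y).filter fun e => f e.1 = g e.2).card =
      ∑ j ∈ T, (X.filter fun u => f u = j).card * (Y.filter fun v => g v = j).card := by
    rw [Finset.card_eq_sum_card_fiberwise (f := fun e => f e.1) (t := T)]
    · refine Finset.sum_congr rfl fun j _ => ?_
      rw [← Finset.card_product]
      congr 1
      ext ⟨u, v⟩
      simp only [Finset.mem_filter, Finset.mem_product]
      constructor
      · rintro ⟨⟨⟨hu, hv⟩, h1⟩, h2⟩
        exact ⟨⟨hu, h2⟩, hv, h1 ▸ h2⟩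
      · rintro ⟨⟨hu, h1⟩, hv, h2⟩
        exact ⟨⟨⟨hu, hv⟩, h1.trans h2.symm⟩, h1⟩
    · intro e he
      exact hf _ (Finset.mem_product.1 (Finset.mem_filter.1 he).1).1
  rw [h1, card_filter_same_eq_sum X f T hf, card_filter_same_eq_sum Y g T hg, Finset.mul_sum,
    ← Finset.sum_add_distrib]
  refine Finset.sum_le_sum fun j _ => ?_
  rw [← mul_assoc]
  exact two_mul_le_add_sq _ _

theorem card_mul_sq_le_card {M : Finset (ℝ × ℝ)} {T : ℝ × ℝ → Finset (ℝ × ℝ)} {m : ℕ}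
    {P : Finset ((ℝ × ℝ) × (ℝ × ℝ))} (hm : ∀ l ∈ M, m ≤ (T l).card)
    (hT : ∀ l ∈ M, ∀ l' ∈ M, ∀ u, u ∈ T l → u ∈ T l' → l = l')
    (hP : ∀ l ∈ M, ∀ u ∈ T l, ∀ v ∈ T l, ((u.2, v.2), (u.1, v.1)) ∈ P) :
    m ^ 2 * M.card ≤ P.card := by
  have h1 : m ^ 2 * M.card ≤ (M.sigma fun l => T l ×ˢ T l).card := by
    rw [Finset.card_sigma, mul_comm, ← smul_eq_mul]
    refine Finset.card_nsmul_le_sum _ _ _ fun l hl => ?_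
    rw [Finset.card_product, sq]
    exact Nat.mul_le_mul (hm l hl) (hm l hl)
  refine h1.trans (Finset.card_le_card_of_injOn
    (fun a => ((a.2.1.2, a.2.2.2), (a.2.1.1, a.2.2.1))) ?_ ?_)
  · rintro ⟨l, u, v⟩ ha
    simp only [Finset.coe_sigma, Set.mem_sigma_iff, Finset.mem_coe, Finset.mem_product] at ha ⊢
    exact hP l ha.1 u ha.2.1 v ha.2.2
  · rintro ⟨l, ⟨u1, u2⟩, ⟨v1, v2⟩⟩ ha ⟨l', ⟨w1, w2⟩, ⟨z1, z2⟩⟩ hb hab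
    simp only [Finset.coe_sigma, Set.mem_sigma_iff, Finset.mem_coe, Finset.mem_product] at ha hb
    simp only [Prod.mk.injEq] at hab
    obtain ⟨⟨rfl, rfl⟩, rfl, rfl⟩ := hab
    obtain rfl := hT l ha.1 l' hb.1 _ ha.2.1 hb.2.1
    rfl

theorem card_sub_eq_sub_le_addE (A : Finset ℝ) :
    (((A ×ˢ A) ×ˢ (A ×ˢ A)).filter fun e => e.1.1 - e.1.2 = e.2.1 - e.2.2).card ≤ addE ℝ A A := by
  refine Finset.card_le_card_of_injOn (fun e => ((e.1.1, e.2.1), (e.1.2, e.2.2))) ?_ ?_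
  · rintro ⟨⟨a, b⟩, ⟨c, d⟩⟩ h
    simp only [Finset.coe_filter, Finset.mem_product, Set.mem_ofPred_eq] at h ⊢
    tauto
  · rintro ⟨⟨a, b⟩, ⟨c, d⟩⟩ - ⟨⟨a', b'⟩, ⟨c', d'⟩⟩ - h
    simp only [Prod.mk.injEq] at h ⊢
    tauto

theorem mulE_le_mulEbar (A : Finset ℝ) (t : ℝ) :
    mulE ℝ (A.image fun a => a - t) (A.image fun a => a - t) ≤ mulEbar ℝ A := by
  refine le_ciSup (f := fun s => mulE ℝ (A.image fun a => a - s) (A.image fun a => a - s))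
    ⟨A.card ^ 4, ?_⟩ t
  rintro _ ⟨s, rfl⟩
  refine (Finset.card_filter_le _ _).trans ?_
  simp only [Finset.card_product]
  have h : (A.image fun a => a - s).card ≤ A.card := Finset.card_image_le
  calc _ ≤ (A.card * A.card) * (A.card * A.card) := by gcongr
    _ = _ := by ring

theorem card_div_eq_div_le_mulEbar (A : Finset ℝ) (t : ℝ) :
    ((((A.filter (· ≠ t)) ×ˢ (A.filter (· ≠ t))) ×ˢ
      ((A.filter (· ≠ t)) ×ˢ (A.filter (· ≠ t)))).filter
      fun e => (e.1.1 - t) / (e.1.2 - t) = (e.2.1 - t) / (e.2.2 - t)).card ≤ mulEbar ℝ A := by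
  refine le_trans ?_ (mulE_le_mulEbar A t)
  refine Finset.card_le_card_of_injOn
    (fun e => ((e.1.1 - t, e.2.1 - t), (e.1.2 - t, e.2.2 - t))) ?_ ?_
  · rintro ⟨⟨a, b⟩, ⟨c, d⟩⟩ h
    simp only [Finset.coe_filter, Finset.mem_product, Set.mem_ofPred_eq, Finset.mem_filter] at h ⊢
    obtain ⟨⟨⟨⟨ha, -⟩, hb, hb'⟩, ⟨hc, -⟩, hd, hd'⟩, h⟩ := h
    rw [div_eq_div_iff (sub_ne_zero.2 hb') (sub_ne_zero.2 hd')] at h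
    exact ⟨⟨⟨Finset.mem_image_of_mem _ ha, Finset.mem_image_of_mem _ hc⟩,
      Finset.mem_image_of_mem _ hb, Finset.mem_image_of_mem _ hd⟩, h⟩
  · rintro ⟨⟨a, b⟩, ⟨c, d⟩⟩ - ⟨⟨a', b'⟩, ⟨c', d'⟩⟩ - h
    simp only [Prod.mk.injEq, sub_left_inj] at h ⊢
    tauto

/-- Parallel rich lines are controlled by the additive energy. -/
theorem sq_mul_card_parallel_le_addE (A : Finset ℝ) (k : ℕ) {a : ℝ} (ha : a ≠ 0) :
    k ^ 2 * ((kRich A k).filter fun l => l.1 = a).card ≤ addE ℝ A A := by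
  have h1 := card_mul_sq_le_card (M := (kRich A k).filter fun l => l.1 = a)
    (T := fun l => (A ×ˢ A).filter fun q => q.2 = l.1 * q.1 + l.2) (m := k)
    (P := ((A ×ˢ A) ×ˢ (A ×ˢ A)).filter fun e => e.1.1 - e.1.2 = a * (e.2.1 - e.2.2))
    (fun l hl => le_nPts_of_mem_kRich (Finset.mem_filter.1 hl).1) ?_ ?_
  · have h2 := two_mul_card_eq_le (A ×ˢ A) (A ×ˢ A) (fun p => p.1 - p.2) (fun p => a * (p.1 - p.2))
    simp only [mul_right_inj' ha] at h2
    have h3 := card_sub_eq_sub_le_addE A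
    omega
  · intro l hl l' hl' u hu hu'
    simp only [Finset.mem_filter] at hl hl' hu hu'
    refine Prod.ext (hl.2.trans hl'.2.symm) ?_
    have h1 := hu.2
    have h2 := hu'.2
    rw [hl.2] at h1
    rw [hl'.2] at h2
    linarith
  · intro l hl u hu v hv
    simp only [Finset.mem_filter, Finset.mem_product] at hl hu hv ⊢
    refine ⟨⟨⟨hu.1.2, hv.1.2⟩, hu.1.1, hv.1.1⟩, ?_⟩
    rw [hu.2, hv.2, hl.2]; ring

/-- Concurrent rich lines are controlled by the multiplicative energy. -/
theorem sq_mul_card_concurrent_le_mulEbar (A : Finset ℝ) {k : ℕ} (hk : 2 ≤ k) (s t : ℝ) :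
    k ^ 2 * ((kRich A k).filter fun l => l.1 * s + l.2 = t).card ≤ 4 * mulEbar ℝ A := by
  have hpt : ∀ l ∈ (kRich A k).filter fun l => l.1 * s + l.2 = t, ∀ u : ℝ × ℝ,
      u.2 = l.1 * u.1 + l.2 → u.2 - t = l.1 * (u.1 - s) := by
    intro l hl u hu
    rw [hu, ← (Finset.mem_filter.1 hl).2]; ring
  have h1 := card_mul_sq_le_card (M := (kRich A k).filter fun l => l.1 * s + l.2 = t)
    (T := fun l => ((A ×ˢ A).filter fun q => q.2 = l.1 * q.1 + l.2).filter fun q => q.1 ≠ s)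
    (m := k - 1)
    (P := (((A.filter (· ≠ t)) ×ˢ (A.filter (· ≠ t))) ×ˢ
      ((A.filter (· ≠ s)) ×ˢ (A.filter (· ≠ s)))).filter
      fun e => (e.1.1 - t) / (e.1.2 - t) = (e.2.1 - s) / (e.2.2 - s)) ?_ ?_ ?_
  · have h2 := two_mul_card_eq_le ((A.filter (· ≠ t)) ×ˢ (A.filter (· ≠ t)))
      ((A.filter (· ≠ s)) ×ˢ (A.filter (· ≠ s))) (fun p => (p.1 - t) / (p.2 - t))
      (fun p => (p.1 - s) / (p.2 - s))
    have h3 := card_div_eq_div_le_mulEbar A s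
    have h4 := card_div_eq_div_le_mulEbar A t
    have h5 : k ^ 2 ≤ 4 * (k - 1) ^ 2 := by
      obtain ⟨m, rfl⟩ := Nat.exists_eq_add_of_le hk
      have : 2 + m - 1 = m + 1 := by omega
      rw [this]
      nlinarith
    calc _ ≤ 4 * (k - 1) ^ 2 * ((kRich A k).filter fun l => l.1 * s + l.2 = t).card :=
          Nat.mul_le_mul_right _ h5
      _ = 4 * ((k - 1) ^ 2 * ((kRich A k).filter fun l => l.1 * s + l.2 = t).card) := by ring
      _ ≤ _ := Nat.mul_le_mul_left _ (h1.trans (by omega))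
  · intro l hl
    have h2 := le_nPts_of_mem_kRich (Finset.mem_filter.1 hl).1
    have h3 := Finset.card_filter_add_card_filter_not
      (s := (A ×ˢ A).filter fun q => q.2 = l.1 * q.1 + l.2) (fun q => q.1 ≠ s)
    have h4 : (((A ×ˢ A).filter fun q => q.2 = l.1 * q.1 + l.2).filter fun q => ¬ q.1 ≠ s).card
        ≤ 1 := by
      refine Finset.card_le_one.2 fun u hu v hv => ?_
      simp only [Finset.mem_filter, not_not] at hu hv
      refine Prod.ext (hu.2.trans hv.2.symm) ?_
      rw [hu.1.2, hv.1.2, hu.2, hv.2]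
    have h5 : nPts A A l = ((A ×ˢ A).filter fun q => q.2 = l.1 * q.1 + l.2).card := rfl
    omega
  · intro l hl l' hl' u hu hu'
    simp only [Finset.mem_filter] at hu hu'
    have h2 := hpt l hl u hu.1.2
    have h3 := hpt l' hl' u hu'.1.2
    have h4 : l.1 = l'.1 := mul_right_cancel₀ (sub_ne_zero.2 hu.2) (h2.symm.trans h3)
    refine Prod.ext h4 ?_
    have h5 := hu.1.2
    rw [hu'.1.2, h4] at h5
    linarith
  · intro l hl u hu v hv
    have hl0 := fst_ne_zero_of_mem_kRich (Finset.mem_filter.1 hl).1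
    simp only [Finset.mem_filter, Finset.mem_product] at hu hv ⊢
    have hu2 := hpt l hl u hu.1.2
    have hv2 := hpt l hl v hv.1.2
    have hu0 := sub_ne_zero.2 hu.2
    have hv0 := sub_ne_zero.2 hv.2
    have hut : u.2 ≠ t := sub_ne_zero.1 (by rw [hu2]; exact mul_ne_zero hl0 hu0)
    have hvt : v.2 ≠ t := sub_ne_zero.1 (by rw [hv2]; exact mul_ne_zero hl0 hv0)
    refine ⟨⟨⟨⟨hu.1.1.2, hut⟩, hv.1.1.2, hvt⟩, ⟨hu.1.1.1, hu.2⟩, hv.1.1.1, hv.2⟩, ?_⟩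
    rw [hu2, hv2, mul_div_mul_left _ _ hl0]

/-- A line of the dual plane contains few rich lines when both energies are small. -/
theorem card_kRich_filter_le (A : Finset ℝ) {k : ℕ} (hk : 2 ≤ k) {B : ℝ}
    (hadd : (addE ℝ A A : ℝ) ≤ B) (hmul : (mulEbar ℝ A : ℝ) ≤ B) (α β γ : ℝ)
    (h : α ≠ 0 ∨ β ≠ 0) :
    (((kRich A k).filter fun p => α * p.1 + β * p.2 = γ).card : ℝ) ≤ 4 * B / (k : ℝ) ^ 2 := by
  have hk0 : (0 : ℝ) < (k : ℝ) ^ 2 := by positivity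
  have hB : 0 ≤ B := le_trans (Nat.cast_nonneg _) hadd
  rw [le_div_iff₀ hk0]
  by_cases hβ : β = 0
  · have hα : α ≠ 0 := h.resolve_right (not_not.2 hβ)
    have h1 : ((kRich A k).filter fun p => α * p.1 + β * p.2 = γ) =
        (kRich A k).filter fun p => p.1 = γ / α := by
      refine Finset.filter_congr fun p _ => ?_
      rw [hβ, eq_div_iff hα, zero_mul, add_zero, mul_comm]
    rw [h1]
    by_cases ha : γ / α = 0
    · have h2 : ((kRich A k).filter fun p => p.1 = γ / α) = ∅ := by
        refine Finset.filter_eq_empty_iff.2 fun p hp => ?_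
        rw [ha]
        exact fst_ne_zero_of_mem_kRich hp
      rw [h2]
      simp
      positivity
    · have h2 : ((k ^ 2 * ((kRich A k).filter fun l => l.1 = γ / α).card : ℕ) : ℝ) ≤ addE ℝ A A :=
        Nat.cast_le.2 (sq_mul_card_parallel_le_addE A k ha)
      push_cast at h2
      linarith
  · have h1 : ((kRich A k).filter fun p => α * p.1 + β * p.2 = γ) =
        (kRich A k).filter fun p => p.1 * (α / β) + p.2 = γ / β := by
      refine Finset.filter_congr fun p _ => ?_
      rw [eq_div_iff hβ]
      have : (p.1 * (α / β) + p.2) * β = α * p.1 + β * p.2 := by field_simp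
      rw [this]
    rw [h1]
    have h2 : ((k ^ 2 * ((kRich A k).filter fun l => l.1 * (α / β) + l.2 = γ / β).card : ℕ) : ℝ) ≤
        ((4 * mulEbar ℝ A : ℕ) : ℝ) :=
      Nat.cast_le.2 (sq_mul_card_concurrent_le_mulEbar A hk _ _)
    push_cast at h2
    linarith

/-- The affine map `y ∘ u⁻¹`. -/
noncomputable def affDiv (e : (ℝ × ℝ) × (ℝ × ℝ)) : ℝ × ℝ :=
  (e.1.1 / e.2.1, e.1.2 - e.1.1 / e.2.1 * e.2.2)

theorem affDiv_apply {l m : ℝ × ℝ} (hm : m.1 ≠ 0) (x : ℝ) :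
    l.1 * x + l.2 = (affDiv (l, m)).1 * (m.1 * x + m.2) + (affDiv (l, m)).2 := by
  simp only [affDiv]
  field_simp
  ring

theorem card_affDiv_eq_le (L : Finset (ℝ × ℝ)) (hL : ∀ l ∈ L, l.1 ≠ 0) :
    (((L ×ˢ L) ×ˢ (L ×ˢ L)).filter fun e => affDiv e.1 = affDiv e.2).card ≤
      ∑ p ∈ L ×ˢ L, (L.filter fun u => affQuot p.1 p.2 u ∈ L).card := by
  rw [← Finset.card_sigma]
  have key : ∀ y u v x : ℝ × ℝ, x ∈ L → affDiv (y, u) = affDiv (v, x) → affQuot x y u = v := by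
    intro y u v x hx h
    have hx0 := hL x hx
    simp only [affDiv, Prod.mk.injEq] at h
    obtain ⟨h1, h2⟩ := h
    refine Prod.ext ?_ ?_
    · simp only [affQuot]
      rw [mul_div_assoc, h1]
      field_simp
    · simp only [affQuot]
      rw [h1] at h2 ⊢
      linarith
  refine Finset.card_le_card_of_injOn (fun e => ⟨(e.2.2, e.1.1), e.1.2⟩) ?_ ?_
  · rintro ⟨⟨y, u⟩, ⟨v, x⟩⟩ h
    simp only [Finset.coe_filter, Finset.mem_product, Set.mem_ofPred_eq, Finset.coe_sigma,
      Set.mem_sigma_iff, Finset.mem_coe] at h ⊢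
    obtain ⟨⟨⟨hy, hu⟩, hv, hx⟩, h⟩ := h
    exact ⟨⟨hx, hy⟩, hu, by rw [key y u v x hx h]; exact hv⟩
  · rintro ⟨⟨y, u⟩, ⟨v, x⟩⟩ h ⟨⟨y', u'⟩, ⟨v', x'⟩⟩ h' he
    simp only [Finset.coe_filter, Finset.mem_product, Set.mem_ofPred_eq] at h h'
    simp only [Sigma.mk.injEq, Prod.mk.injEq, heq_eq_eq] at he
    obtain ⟨⟨rfl, rfl⟩, rfl⟩ := he
    rw [← key y u v x h.1.2.2 h.2, ← key y u v' x h'.1.2.2 h'.2]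

theorem sum_card_filter_eq_sum_nPts (A : Finset ℝ) (L : Finset (ℝ × ℝ)) :
    ∑ x ∈ A, (L.filter fun l => l.1 * x + l.2 ∈ A).card = ∑ l ∈ L, nPts A A l := by
  simp only [Finset.card_filter]
  rw [Finset.sum_comm]
  refine Finset.sum_congr rfl fun l _ => ?_
  rw [← Finset.card_filter]
  refine Finset.card_bij' (fun x _ => (x, l.1 * x + l.2)) (fun q _ => q.1) ?_ ?_ ?_ ?_
  · intro x hx
    simp only [Finset.mem_filter, Finset.mem_product] at hx ⊢
    exact ⟨hx, trivial⟩
  · intro q hq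
    simp only [Finset.mem_filter, Finset.mem_product] at hq ⊢
    rw [← hq.2]
    exact hq.1
  · intro x _; rfl
  · intro q hq
    exact Prod.ext rfl (Finset.mem_filter.1 hq).2.symm

theorem sum_sq_card_filter_le (A : Finset ℝ) (L : Finset (ℝ × ℝ)) (hL : ∀ l ∈ L, l.1 ≠ 0) :
    ∑ x ∈ A, (L.filter fun l => l.1 * x + l.2 ∈ A).card ^ 2 ≤
      ∑ e ∈ L ×ˢ L, nPts A A (affDiv e) := by
  have h1 : ∀ x ∈ A, (L.filter fun l => l.1 * x + l.2 ∈ A).card ^ 2 =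
      ∑ e ∈ L ×ˢ L, if e.1.1 * x + e.1.2 ∈ A ∧ e.2.1 * x + e.2.2 ∈ A then 1 else 0 := by
    intro x _
    rw [sq, ← Finset.card_product, ← Finset.card_filter, ← Finset.filter_product]
  rw [Finset.sum_congr rfl h1, Finset.sum_comm]
  refine Finset.sum_le_sum fun e he => ?_
  rw [← Finset.card_filter]
  have he2 := hL _ (Finset.mem_product.1 he).2
  refine Finset.card_le_card_of_injOn
    (fun x => (e.2.1 * x + e.2.2, e.1.1 * x + e.1.2)) ?_ ?_
  · intro x hx
    simp only [Finset.coe_filter, Finset.mem_product, Set.mem_ofPred_eq] at hx ⊢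
    exact ⟨⟨hx.2.2, hx.2.1⟩, affDiv_apply he2 x⟩
  · intro x _ y _ hxy
    simp only [Prod.mk.injEq, add_left_inj, mul_right_inj' he2] at hxy
    exact hxy.1

/-- Many rich lines have large energy in the affine group. -/
theorem card_kRich_pow_four_le (A : Finset ℝ) (k : ℕ) (hA : 0 < A.card)
    (hk : 8 * A.card ≤ k ^ 2) :
    (kRich A k).card ^ 4 * k ^ 6 ≤ 1024 * A.card ^ 7 * ∑ p ∈ kRich A k ×ˢ kRich A k,
      ((kRich A k).filter fun u => affQuot p.1 p.2 u ∈ kRich A k).card := by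
  set L := kRich A k with hLdef
  have hL : ∀ l ∈ L, l.1 ≠ 0 := fun _ => fst_ne_zero_of_mem_kRich
  set n := A.card with hn
  set N := L.card with hN
  set r := k ^ 2 / (8 * n) with hr
  have hr1 : 1 ≤ r := (Nat.one_le_div_iff (by omega)).2 hk
  have hrk : 8 * n * r ≤ k ^ 2 := Nat.mul_div_le _ _
  have hkr : k ^ 2 ≤ 16 * n * r := by
    have h1 : k ^ 2 < 8 * n * (r + 1) := Nat.lt_mul_div_succ _ (by omega)
    nlinarith
  set W := ∑ e ∈ L ×ˢ L, nPts A A (affDiv e) with hW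
  set F := (L ×ˢ L).filter fun e => 4 * r ≤ nPts A A (affDiv e) with hF
  set U := ∑ e ∈ F, nPts A A (affDiv e) with hU
  set V := ∑ g ∈ F.image affDiv, nPts A A g ^ 2 with hV
  set E := ∑ p ∈ L ×ˢ L, (L.filter fun u => affQuot p.1 p.2 u ∈ L).card with hE
  have hNk : (N * k) ^ 2 ≤ n * W := by
    have h1 : N * k ≤ ∑ l ∈ L, nPts A A l := by
      rw [← smul_eq_mul]
      exact Finset.card_nsmul_le_sum _ _ _ fun l hl => le_nPts_of_mem_kRich hl
    rw [← sum_card_filter_eq_sum_nPts] at h1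
    calc (N * k) ^ 2 ≤ _ := Nat.pow_le_pow_left h1 2
      _ ≤ n * _ := sq_sum_le_card_mul_sum_sq
      _ ≤ n * W := Nat.mul_le_mul_left _ (sum_sq_card_filter_le A L hL)
  have hWU : W ≤ U + N ^ 2 * (4 * r) := by
    rw [hW, ← Finset.sum_filter_add_sum_filter_not (L ×ˢ L)
      (fun e => 4 * r ≤ nPts A A (affDiv e))]
    refine Nat.add_le_add_left ?_ _
    have h1 : ((L ×ˢ L).filter fun e => ¬ 4 * r ≤ nPts A A (affDiv e)).card ≤ N ^ 2 := by
      refine (Finset.card_filter_le _ _).trans ?_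
      rw [Finset.card_product, sq]
    refine (Finset.sum_le_card_nsmul _ _ (4 * r) fun e he => ?_).trans ?_
    · exact (not_le.1 (Finset.mem_filter.1 he).2).le
    · rw [smul_eq_mul]
      exact Nat.mul_le_mul_right _ h1
  have hU2 : U ^ 2 ≤ E * V := by
    have h1 : U = ∑ g ∈ F.image affDiv, (F.filter fun e => affDiv e = g).card * nPts A A g := by
      rw [hU, Finset.sum_comp (nPts A A) affDiv]
      simp only [smul_eq_mul]
    have h2 : ∑ g ∈ F.image affDiv, (F.filter fun e => affDiv e = g).card ^ 2 ≤ E := by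
      rw [← card_filter_same_eq_sum F affDiv (F.image affDiv)
        fun u hu => Finset.mem_image_of_mem _ hu]
      refine le_trans (Finset.card_le_card (Finset.filter_subset_filter _ ?_))
        (card_affDiv_eq_le L hL)
      exact Finset.product_subset_product (Finset.filter_subset _ _) (Finset.filter_subset _ _)
    rw [h1]
    exact (Finset.sum_mul_sq_le_sq_mul_sq _ _ _).trans (Nat.mul_le_mul_right _ h2)
  have hrV : r * V ≤ 16 * n ^ 4 := by
    refine mul_sum_nPts_sq_le A (F.image affDiv) ?_ hr1 ?_
    · intro g hg
      obtain ⟨e, he, rfl⟩ := Finset.mem_image.1 hg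
      have := Finset.mem_product.1 (Finset.mem_filter.1 he).1
      exact div_ne_zero (hL _ this.1) (hL _ this.2)
    · intro g hg
      obtain ⟨e, he, rfl⟩ := Finset.mem_image.1 hg
      exact (Finset.mem_filter.1 he).2
  have hmain : N ^ 2 * k ^ 2 ≤ 2 * n * U := by
    have h1 : n * W ≤ n * (U + N ^ 2 * (4 * r)) := Nat.mul_le_mul_left _ hWU
    have h2 : N ^ 2 * (8 * n * r) ≤ N ^ 2 * k ^ 2 := Nat.mul_le_mul_left _ hrk
    nlinarith
  calc N ^ 4 * k ^ 6 = (N ^ 2 * k ^ 2) ^ 2 * k ^ 2 := by ring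
    _ ≤ (2 * n * U) ^ 2 * (16 * n * r) := Nat.mul_le_mul (Nat.pow_le_pow_left hmain 2) hkr
    _ = 64 * n ^ 3 * r * U ^ 2 := by ring
    _ ≤ 64 * n ^ 3 * r * (E * V) := Nat.mul_le_mul_left _ hU2
    _ = 64 * n ^ 3 * E * (r * V) := by ring
    _ ≤ 64 * n ^ 3 * E * (16 * n ^ 4) := Nat.mul_le_mul_left _ hrV
    _ = _ := by ring

theorem sq_card_le_addE (A : Finset ℝ) : A.card ^ 2 ≤ addE ℝ A A := by
  rw [sq, ← Finset.card_product]
  refine Finset.card_le_card_of_injOn (fun p => ((p.1, p.1), (p.2, p.2))) ?_ ?_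
  · rintro ⟨a, b⟩ h
    simp only [Finset.coe_product, Set.mem_prod, Finset.mem_coe, Finset.coe_filter,
      Finset.mem_product, Set.mem_ofPred_eq] at h ⊢
    tauto
  · rintro ⟨a, b⟩ - ⟨a', b'⟩ - h
    simp only [Prod.mk.injEq] at h ⊢
    tauto

/-- The scaled number of `k`-rich lines decays like `k ^ (-3 / 2)`. -/
theorem pow_ten_kRich_le (A : Finset ℝ) (hA : 0 < A.card) {B τ : ℝ}
    (hτ : B * (A.card : ℝ) ^ 2 = τ ^ 5)
    (hadd : (addE ℝ A A : ℝ) ≤ B) (hmul : (mulEbar ℝ A : ℝ) ≤ B) {k : ℕ} (hk : 2 ≤ k) :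
    ((k : ℝ) ^ 3 * (kRich A k).card / (A.card : ℝ) ^ 4) ^ 10 * (k : ℝ) ^ 15 ≤
      (10000 : ℝ) ^ 10 * τ ^ 15 := by
  set n : ℝ := (A.card : ℝ) with hn
  set N : ℝ := ((kRich A k).card : ℝ) with hN
  set z : ℝ := (k : ℝ) ^ 3 * N / n ^ 4 with hz
  have hn1 : 1 ≤ n := Nat.one_le_cast.2 hA
  have hk2 : (2 : ℝ) ≤ k := by exact_mod_cast hk
  have hn0 : 0 < n := by linarith
  have hk0 : (0 : ℝ) < k := by linarith
  have hN0 : 0 ≤ N := Nat.cast_nonneg _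
  have hz0 : 0 ≤ z := by positivity
  have hz1 : z ≤ 112 := by
    rw [hz, div_le_iff₀ (by positivity), hN, hn]
    exact_mod_cast pow_three_mul_card_kRich_le A k
  have hnB : n ^ 2 ≤ B := le_trans (by rw [hn]; exact_mod_cast sq_card_le_addE A) hadd
  have hB0 : 0 ≤ B := le_trans (by positivity) hnB
  have hτ0 : 0 ≤ τ ^ 15 := by
    have : τ ^ 15 = (B * n ^ 2) ^ 3 := by rw [hτ]; ring
    rw [this]; positivity
  rcases le_or_gt (8 * A.card) (k ^ 2) with h | h
  · rcases hN0.eq_or_lt with h0 | hNpos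
    · rw [hz, ← h0]
      simp only [mul_zero, zero_div]
      rw [zero_pow (by norm_num), zero_mul]
      positivity
    set E : ℝ := ∑ p ∈ kRich A k ×ˢ kRich A k,
      (((kRich A k).filter fun u => affQuot p.1 p.2 u ∈ kRich A k).card : ℝ) with hE
    have h1 : N ^ 4 * (k : ℝ) ^ 6 ≤ 1024 * n ^ 7 * E := by
      rw [hN, hn, hE]
      exact_mod_cast card_kRich_pow_four_le A k hA h
    have h2 : E ^ 2 ≤ 20000 * (4 * B / (k : ℝ) ^ 2) * N ^ 5 :=
      affine_energy_sq_le (kRich A k) (fun _ => fst_ne_zero_of_mem_kRich) _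
        (card_kRich_filter_le A hk hadd hmul)
    have h3 : (N ^ 3 * (k : ℝ) ^ 14) * N ^ 5 ≤ (1024 ^ 2 * 80000 * n ^ 14 * B) * N ^ 5 := by
      calc (N ^ 3 * (k : ℝ) ^ 14) * N ^ 5 = (N ^ 4 * (k : ℝ) ^ 6) ^ 2 * (k : ℝ) ^ 2 := by ring
        _ ≤ (1024 * n ^ 7 * E) ^ 2 * (k : ℝ) ^ 2 := by gcongr
        _ = 1024 ^ 2 * n ^ 14 * E ^ 2 * (k : ℝ) ^ 2 := by ring
        _ ≤ 1024 ^ 2 * n ^ 14 * (20000 * (4 * B / (k : ℝ) ^ 2) * N ^ 5) * (k : ℝ) ^ 2 := by gcongr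
        _ = _ := by field_simp; ring
    have h4 := le_of_mul_le_mul_right h3 (by positivity)
    have h5 : z ^ 3 * (k : ℝ) ^ 5 ≤ 1024 ^ 2 * 80000 * τ ^ 5 := by
      have e : z ^ 3 * (k : ℝ) ^ 5 = N ^ 3 * (k : ℝ) ^ 14 / n ^ 12 := by
        rw [hz]; field_simp
      rw [e, div_le_iff₀ (by positivity), ← hτ]
      linarith
    calc z ^ 10 * (k : ℝ) ^ 15 = z * (z ^ 3 * (k : ℝ) ^ 5) ^ 3 := by ring
      _ ≤ 112 * (1024 ^ 2 * 80000 * τ ^ 5) ^ 3 := by gcongr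
      _ = 112 * (1024 ^ 2 * 80000) ^ 3 * τ ^ 15 := by ring
      _ ≤ _ := mul_le_mul_of_nonneg_right (by norm_num) hτ0
  · have h' : (k : ℝ) ^ 2 ≤ 8 * n := by rw [hn]; exact_mod_cast h.le
    have h1 : n ^ 8 ≤ τ ^ 15 := by
      calc n ^ 8 ≤ n ^ 12 := pow_le_pow_right₀ hn1 (by norm_num)
        _ = (n ^ 2 * n ^ 2) ^ 3 := by ring
        _ ≤ (B * n ^ 2) ^ 3 := by gcongr
        _ = τ ^ 15 := by rw [hτ]; ring
    calc z ^ 10 * (k : ℝ) ^ 15 ≤ 112 ^ 10 * (k : ℝ) ^ 16 := by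
          gcongr
          · linarith
          · norm_num
      _ = 112 ^ 10 * ((k : ℝ) ^ 2) ^ 8 := by ring
      _ ≤ 112 ^ 10 * (8 * n) ^ 8 := by gcongr
      _ = 112 ^ 10 * 8 ^ 8 * n ^ 8 := by ring
      _ ≤ 112 ^ 10 * 8 ^ 8 * τ ^ 15 := by gcongr
      _ ≤ _ := mul_le_mul_of_nonneg_right (by norm_num) hτ0

theorem sum_le_of_sq_mul_pow_three_le (z : ℕ → ℝ) {M w : ℝ} (hw : 1 ≤ w) (hM : 0 ≤ M)
    (hzM : ∀ k, z k ≤ M) (hz : ∀ k, 2 ≤ k → z k ^ 2 * (k : ℝ) ^ 3 ≤ (M * w ^ 3) ^ 2) (n : ℕ) :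
    ∑ j ∈ Finset.range n, z (j + 1) ≤ 4 * M * w ^ 2 := by
  have hw0 : 0 < w := by linarith
  have htriv : ∀ m : ℕ, ∑ j ∈ Finset.range m, z (j + 1) ≤ M * m := by
    intro m
    refine (Finset.sum_le_card_nsmul _ _ M fun j _ => hzM _).trans ?_
    rw [Finset.card_range, nsmul_eq_mul, mul_comm]
  have hmain : ∀ m : ℕ, w ^ 2 < m →
      ∑ j ∈ Finset.range m, z (j + 1) ≤ M * (4 * w ^ 2 - 2 * w ^ 3 / √m) := by
    intro m
    induction m with
    | zero =>
      intro h
      exact absurd h (by push_cast; nlinarith)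
    | succ m ih =>
      intro h
      have hs0 : 0 < √((m + 1 : ℕ) : ℝ) := Real.sqrt_pos.2 (by positivity)
      have hs2 : √((m + 1 : ℕ) : ℝ) ^ 2 = m + 1 := by
        rw [Real.sq_sqrt (by positivity)]; push_cast; rfl
      set s := √((m + 1 : ℕ) : ℝ) with hs
      rcases le_or_gt (m : ℝ) (w ^ 2) with hm | hm
      · refine (htriv _).trans (mul_le_mul_of_nonneg_left ?_ hM)
        have hws : w ≤ s := by
          refine le_of_lt (lt_of_pow_lt_pow_left₀ 2 hs0.le ?_)
          rw [hs2]; push_cast at h; exact h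
        have h1 : 2 * w ^ 3 / s ≤ 2 * w ^ 2 := by
          rw [div_le_iff₀ hs0]; nlinarith [sq_nonneg w]
        push_cast
        nlinarith
      · have hm0 : 0 < (m : ℝ) := lt_trans (by positivity) hm
        have hm1 : 1 ≤ m := by
          have : 0 < m := by exact_mod_cast hm0
          omega
        have ht0 : 0 < √(m : ℝ) := Real.sqrt_pos.2 hm0
        have ht2 : √(m : ℝ) ^ 2 = m := Real.sq_sqrt hm0.le
        have hih := ih hm
        set t := √(m : ℝ) with ht
        have hts : t ≤ s := Real.sqrt_le_sqrt (by push_cast; linarith)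
        have hzk : z (m + 1) ≤ M * w ^ 3 / s ^ 3 := by
          rw [le_div_iff₀ (by positivity)]
          refine le_of_sq_le_sq ?_ (by positivity)
          have h1 := hz (m + 1) (by omega)
          calc (z (m + 1) * s ^ 3) ^ 2 = z (m + 1) ^ 2 * (s ^ 2) ^ 3 := by ring
            _ = z (m + 1) ^ 2 * ((m + 1 : ℕ) : ℝ) ^ 3 := by rw [hs2]; push_cast; rfl
            _ ≤ _ := h1
        have htel : 1 / s ^ 3 ≤ 2 / t - 2 / s := by
          have e1 : (s - t) * (s + t) = 1 := by linear_combination hs2 - ht2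
          have e2 : 2 / t - 2 / s = 2 * (s - t) / (s * t) := by field_simp
          rw [e2, div_le_div_iff₀ (by positivity) (by positivity)]
          have e3 : 1 * (s * t) * 1 ≤ 2 * (s - t) * s ^ 3 := by
            have h1 : t * (s + t) ≤ 2 * s ^ 2 := by nlinarith
            have h2 : 0 ≤ s * (s - t) := mul_nonneg hs0.le (sub_nonneg.2 hts)
            calc 1 * (s * t) * 1 = s * t * ((s - t) * (s + t)) := by rw [e1]; ring
              _ = (s * (s - t)) * (t * (s + t)) := by ring
              _ ≤ (s * (s - t)) * (2 * s ^ 2) := mul_le_mul_of_nonneg_left h1 h2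
              _ = _ := by ring
          linarith
        rw [Finset.sum_range_succ]
        have h3 : M * w ^ 3 / s ^ 3 ≤ M * w ^ 3 * (2 / t - 2 / s) := by
          rw [div_eq_mul_one_div]
          exact mul_le_mul_of_nonneg_left htel (by positivity)
        have h4 : M * (4 * w ^ 2 - 2 * w ^ 3 / t) + M * w ^ 3 * (2 / t - 2 / s) =
            M * (4 * w ^ 2 - 2 * w ^ 3 / s) := by ring
        linarith
  rcases le_or_gt (n : ℝ) (w ^ 2) with h | h
  · refine (htriv n).trans ?_
    nlinarith [mul_le_mul_of_nonneg_left h hM, sq_nonneg w]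
  · refine (hmain n h).trans ?_
    have : 0 ≤ 2 * w ^ 3 / √n := by positivity
    nlinarith

theorem Ctuples_four_sub_le (A : Finset ℝ) (hA : 0 < A.card) {B τ : ℝ} (hτ0 : 0 ≤ τ)
    (hτ : B * (A.card : ℝ) ^ 2 = τ ^ 5)
    (hadd : (addE ℝ A A : ℝ) ≤ B) (hmul : (mulEbar ℝ A : ℝ) ≤ B) :
    (Ctuples ℝ 4 A A : ℝ) - 2 * (A.card : ℝ) ^ 5 ≤ 160000 * ((A.card : ℝ) ^ 4 * τ) := by
  set n : ℝ := (A.card : ℝ) with hn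
  have hn1 : 1 ≤ n := Nat.one_le_cast.2 hA
  have hn0 : 0 < n := by linarith
  set z : ℕ → ℝ := fun k => (k : ℝ) ^ 3 * (kRich A k).card / n ^ 4 with hz
  have hnB : n ^ 2 ≤ B := le_trans (by rw [hn]; exact_mod_cast sq_card_le_addE A) hadd
  have hτ1 : 1 ≤ τ := by
    by_contra! h
    have h1 : τ ^ 5 < 1 := pow_lt_one₀ hτ0 h (by norm_num)
    have h2 : 1 ≤ n ^ 2 := one_le_pow₀ hn1
    nlinarith
  have hw : √τ ^ 2 = τ := Real.sq_sqrt hτ0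
  have hsum := sum_le_of_sq_mul_pow_three_le z (M := 10000) (w := √τ) (Real.one_le_sqrt.2 hτ1)
    (by norm_num) ?_ ?_ A.card
  · have h1 : (Ctuples ℝ 4 A A : ℝ) ≤ 2 * n ^ 5 + ∑ k ∈ Finset.range A.card,
        4 * ((k : ℝ) + 1) ^ 3 * (kRich A (k + 1)).card := by
      rw [hn]
      exact_mod_cast Ctuples_four_le A
    have h2 : ∑ k ∈ Finset.range A.card, 4 * ((k : ℝ) + 1) ^ 3 * (kRich A (k + 1)).card =
        4 * n ^ 4 * ∑ k ∈ Finset.range A.card, z (k + 1) := by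
      rw [Finset.mul_sum]
      refine Finset.sum_congr rfl fun k _ => ?_
      simp only [hz]
      push_cast
      field_simp
    rw [hw] at hsum
    have h3 : 4 * n ^ 4 * ∑ k ∈ Finset.range A.card, z (k + 1) ≤ 4 * n ^ 4 * (4 * 10000 * τ) := by
      gcongr
    linarith
  · intro k
    simp only [hz]
    rw [div_le_iff₀ (by positivity)]
    have h1 : (k : ℝ) ^ 3 * (kRich A k).card ≤ 112 * n ^ 4 := by
      rw [hn]
      exact_mod_cast pow_three_mul_card_kRich_le A k
    have h2 : 0 ≤ n ^ 4 := by positivity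
    linarith
  · intro k hk
    have h1 := pow_ten_kRich_le A hA hτ hadd hmul hk
    refine le_of_pow_le_pow_left₀ (n := 5) (by norm_num) (by positivity) ?_
    have e : ((10000 * √τ ^ 3) ^ 2) ^ 5 = 10000 ^ 10 * τ ^ 15 := by
      calc ((10000 * √τ ^ 3) ^ 2) ^ 5 = 10000 ^ 10 * (√τ ^ 2) ^ 15 := by ring
        _ = _ := by rw [hw]
    rw [e]
    calc (z k ^ 2 * (k : ℝ) ^ 3) ^ 5 = z k ^ 10 * (k : ℝ) ^ 15 := by ring
      _ ≤ _ := h1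

theorem stmt2 (c : ℝ) (hc : 0 < c) :
    ∃ C : ℝ, 0 < C ∧ ∀ A : Finset ℝ,
      (addE ℝ A A : ℝ) ≤ (A.card : ℝ) ^ (3 - c) →
      (mulEbar ℝ A : ℝ) ≤ (A.card : ℝ) ^ (3 - c) →
      (Ctuples ℝ 4 A A : ℝ) - 2 * (A.card : ℝ) ^ 5 ≤
        C * (A.card : ℝ) ^ (5 - c / 5) * Real.log A.card ^ (4 / 5 : ℝ) := by
  have hlog2 : 0 < Real.log 2 := Real.log_pos (by norm_num)
  have hl0 : 0 < Real.log 2 ^ (4 / 5 : ℝ) := Real.rpow_pos_of_pos hlog2 _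
  refine ⟨160000 / Real.log 2 ^ (4 / 5 : ℝ), by positivity, fun A hadd hmul => ?_⟩
  rcases lt_or_ge A.card 2 with h | h
  · have h1 : Ctuples ℝ 4 A A ≤ 2 * A.card ^ 5 := by
      refine (Finset.card_filter_le _ _).trans ?_
      rw [Fintype.card_piFinset_const, Finset.card_product]
      interval_cases A.card <;> simp
    have h2 : (Ctuples ℝ 4 A A : ℝ) ≤ 2 * (A.card : ℝ) ^ 5 := by exact_mod_cast h1
    have h3 : 0 ≤ Real.log A.card ^ (4 / 5 : ℝ) := Real.rpow_nonneg (Real.log_natCast_nonneg _) _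
    have h4 : 0 ≤ 160000 / Real.log 2 ^ (4 / 5 : ℝ) * (A.card : ℝ) ^ (5 - c / 5) *
        Real.log A.card ^ (4 / 5 : ℝ) := by positivity
    linarith
  · have hn2 : (2 : ℝ) ≤ A.card := by exact_mod_cast h
    have hn0 : (0 : ℝ) < A.card := by linarith
    have h1 := Ctuples_four_sub_le A (by omega) (B := (A.card : ℝ) ^ (3 - c))
      (τ := (A.card : ℝ) ^ (1 - c / 5)) (by positivity) ?_ hadd hmul
    · have h2 : (A.card : ℝ) ^ 4 * (A.card : ℝ) ^ (1 - c / 5) = (A.card : ℝ) ^ (5 - c / 5) := by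
        rw [← Real.rpow_natCast, ← Real.rpow_add hn0]
        congr 1
        push_cast
        ring
      rw [h2] at h1
      have h3 : Real.log 2 ^ (4 / 5 : ℝ) ≤ Real.log A.card ^ (4 / 5 : ℝ) :=
        Real.rpow_le_rpow hlog2.le (Real.log_le_log (by norm_num) hn2) (by norm_num)
      refine h1.trans ?_
      have h4 : 0 ≤ (A.card : ℝ) ^ (5 - c / 5) := by positivity
      calc 160000 * (A.card : ℝ) ^ (5 - c / 5) = 160000 / Real.log 2 ^ (4 / 5 : ℝ) *
            (A.card : ℝ) ^ (5 - c / 5) * Real.log 2 ^ (4 / 5 : ℝ) := by field_simp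
        _ ≤ _ := by gcongr
    · rw [← Real.rpow_natCast, ← Real.rpow_natCast, ← Real.rpow_mul hn0.le, ← Real.rpow_add hn0]
      congr 1
      push_cast
      ring
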